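/- arXiv:1702.05356 — 4 statements merged into one kernel-verified Lean document; each statement's English description precedes it below -/
import Mathlib

section
/- Let P be a Markov operator on finite Borel measures on S¹ (positively linear and preserving total mass) that admits at least one invariant Borel probability measure. Assume: for every ε>0 and every continuous f:S¹→ℝ there exists α>0 such that for all Borel probability measures μ₁,μ₂ on S¹ there exist Borel probability measures ν₁,ν₂ and N∈ℕ with P^N μᵢ ≥ α νᵢ (as measures) for i=1,2, and limsup_{n→∞} |∫ f d(Pⁿν₁) − ∫ f d(Pⁿν₂)| ≤ ε. Then P is asymptotically stable: it has a unique invariant Borel probability measure μ* and for every Borel probability measure μ and every continuous f, ∫ f d(Pⁿμ) → ∫ f dμ* as n→∞. -/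
open MeasureTheory Filter Topology

noncomputable section

/-- The circle `ℝ/ℤ` with normalized arc length (Haar probability measure as `volume`). -/
abbrev S1 : Type := UnitAddCircle

/-- `h` is an orientation-preserving circle homeomorphism: it admits a strictly increasing
continuous lift `G : ℝ → ℝ` with `G (t+1) = G t + 1`. -/
def IsOPH (h : S1 ≃ₜ S1) : Prop :=
  ∃ G : ℝ → ℝ, StrictMono G ∧ Continuous G ∧ (∀ t, G (t + 1) = G t + 1) ∧
    ∀ t : ℝ, h ((t : ℝ) : S1) = ((G t : ℝ) : S1)

/-- For a word `w = [i₁, …, i_n]`, `applyWord g w = g_{i_n} ∘ ⋯ ∘ g_{i_1}`. -/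
def applyWord {k : ℕ} (g : Fin k → S1 ≃ₜ S1) (w : List (Fin k)) (x : S1) : S1 :=
  w.foldl (fun y i => g i y) x

/-- `Γ` is admissible: some generator has a dense forward orbit `{gᵢⁿ x : n ≥ 1}`. -/
def Admissible {k : ℕ} (g : Fin k → S1 ≃ₜ S1) : Prop :=
  ∃ i : Fin k, ∃ x : S1, Dense (Set.range fun n : ℕ => (⇑(g i))^[n + 1] x)

/-- The action of `Γ` is contractive: every `x` has an open arc neighbourhood whose image
under suitable words has Haar measure tending to `0`. -/
def Contractive {k : ℕ} (g : Fin k → S1 ≃ₜ S1) : Prop :=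
  ∀ x : S1, ∃ a b : ℝ, a < b ∧ b - a < 1 ∧
    x ∈ (fun t : ℝ => (t : S1)) '' Set.Ioo a b ∧
    ∃ w : ℕ → List (Fin k),
      Tendsto (fun m => volume (applyWord g (w m) '' ((fun t : ℝ => (t : S1)) '' Set.Ioo a b)))
        atTop (𝓝 0)

/-- The Markov operator `P μ = ∑ᵢ pᵢ • (gᵢ)_* μ` of the IFS `(Γ, p)`. -/
def markovP {k : ℕ} (p : Fin k → ℝ) (g : Fin k → S1 ≃ₜ S1) (μ : Measure S1) : Measure S1 :=
  ∑ i : Fin k, ENNReal.ofReal (p i) • Measure.map (g i) μ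

/-- The dual operator `P* f x = ∑ᵢ pᵢ f (gᵢ x)`. -/
def dualP {k : ℕ} (p : Fin k → ℝ) (g : Fin k → S1 ≃ₜ S1) (f : S1 → ℝ) (x : S1) : ℝ :=
  ∑ i : Fin k, p i * f (g i x)

/-- Asymptotic stability of the IFS `(Γ, p)`: there is a unique invariant Borel probability
measure `μ*`, and `Pⁿ μ → μ*` weakly for every Borel probability measure `μ`. -/
def AsympStable {k : ℕ} (p : Fin k → ℝ) (g : Fin k → S1 ≃ₜ S1) : Prop :=
  ∃ μs : Measure S1, IsProbabilityMeasure μs ∧ markovP p g μs = μs ∧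
    (∀ ν : Measure S1, IsProbabilityMeasure ν → markovP p g ν = ν → ν = μs) ∧
    ∀ μ : Measure S1, IsProbabilityMeasure μ → ∀ f : C(S1, ℝ),
      Tendsto (fun n => ∫ x, f x ∂((markovP p g)^[n] μ)) atTop (𝓝 (∫ x, f x ∂μs))

open scoped ENNReal NNReal

section MarkovOperator

variable {X : Type*} [MeasurableSpace X] {P : Measure X → Measure X}

theorem isProbabilityMeasure_iterate
    (hmass : ∀ μ : Measure X, IsFiniteMeasure μ → P μ Set.univ = μ Set.univ)
    (n : ℕ) {μ : Measure X} (hμ : IsProbabilityMeasure μ) : IsProbabilityMeasure (P^[n] μ) := by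
  induction n with
  | zero => exact hμ
  | succ n ih =>
    rw [Function.iterate_succ_apply']
    exact ⟨(hmass _ inferInstance).trans measure_univ⟩

theorem iterate_smul_add_smul
    (hlin : ∀ (c₁ c₂ : ℝ≥0) (μ₁ μ₂ : Measure X), IsFiniteMeasure μ₁ → IsFiniteMeasure μ₂ →
      P ((c₁ : ℝ≥0∞) • μ₁ + (c₂ : ℝ≥0∞) • μ₂) = (c₁ : ℝ≥0∞) • P μ₁ + (c₂ : ℝ≥0∞) • P μ₂)
    (hmass : ∀ μ : Measure X, IsFiniteMeasure μ → P μ Set.univ = μ Set.univ)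
    (n : ℕ) (c₁ c₂ : ℝ≥0) {μ₁ μ₂ : Measure X}
    (h₁ : IsProbabilityMeasure μ₁) (h₂ : IsProbabilityMeasure μ₂) :
    P^[n] ((c₁ : ℝ≥0∞) • μ₁ + (c₂ : ℝ≥0∞) • μ₂) =
      (c₁ : ℝ≥0∞) • P^[n] μ₁ + (c₂ : ℝ≥0∞) • P^[n] μ₂ := by
  induction n with
  | zero => rfl
  | succ n ih =>
    have := isProbabilityMeasure_iterate hmass n h₁
    have := isProbabilityMeasure_iterate hmass n h₂
    simp only [Function.iterate_succ_apply', ih]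
    exact hlin _ _ _ _ inferInstance inferInstance

theorem exists_isProbabilityMeasure_eq_smul_add_smul {a b : ℝ≥0} (hab : a + b = 1) (hb : b ≠ 0)
    {μ ν : Measure X} (hμ : IsProbabilityMeasure μ) (hν : IsProbabilityMeasure ν)
    (h : (a : ℝ≥0∞) • ν ≤ μ) :
    ∃ ρ : Measure X, IsProbabilityMeasure ρ ∧ μ = (a : ℝ≥0∞) • ν + (b : ℝ≥0∞) • ρ := by
  have hb0 : (b : ℝ≥0∞) ≠ 0 := by simpa using hb
  have : IsFiniteMeasure ((a : ℝ≥0∞) • ν) := Measure.smul_finite ν ENNReal.coe_ne_top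
  refine ⟨(b : ℝ≥0∞)⁻¹ • (μ - (a : ℝ≥0∞) • ν), ⟨?_⟩, ?_⟩
  · have h1 : (1 : ℝ≥0∞) - a = b := by
      rw [← ENNReal.coe_one, ← hab]
      push_cast
      exact ENNReal.add_sub_cancel_left ENNReal.coe_ne_top
    rw [Measure.smul_apply, Measure.sub_apply MeasurableSet.univ h, Measure.smul_apply]
    simp [h1, ENNReal.inv_mul_cancel hb0 ENNReal.coe_ne_top]
  · rw [smul_smul, ENNReal.mul_inv_cancel hb0 ENNReal.coe_ne_top, one_smul, add_comm,
      Measure.sub_add_cancel_of_le h]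

variable [TopologicalSpace X] [CompactSpace X]

theorem abs_integral_sub_integral_le (f : C(X, ℝ)) (μ ν : Measure X)
    [IsProbabilityMeasure μ] [IsProbabilityMeasure ν] :
    |∫ x, f x ∂μ - ∫ x, f x ∂ν| ≤ ‖f‖ + ‖f‖ := by
  have key (κ : Measure X) [IsProbabilityMeasure κ] : ‖∫ x, f x ∂κ‖ ≤ ‖f‖ := by
    simpa using norm_integral_le_of_norm_le_const (μ := κ) (ae_of_all _ f.norm_coe_le_norm)
  exact (norm_sub_le _ _).trans (add_le_add (key μ) (key ν))

/-- `P` eventually brings the `f`-integrals of any two probability measures within `C`. -/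
def EventuallyWithin (P : Measure X → Measure X) (f : C(X, ℝ)) (C : ℝ) : Prop :=
  ∀ μ₁ μ₂ : Measure X, IsProbabilityMeasure μ₁ → IsProbabilityMeasure μ₂ →
    ∀ᶠ n in atTop, |∫ x, f x ∂(P^[n] μ₁) - ∫ x, f x ∂(P^[n] μ₂)| ≤ C

variable [OpensMeasurableSpace X]

theorem ContinuousMap.integrable_of_isFiniteMeasure (f : C(X, ℝ)) (μ : Measure X)
    [IsFiniteMeasure μ] : Integrable f μ :=
  (BoundedContinuousFunction.mkOfCompact f).integrable μ

theorem integral_smul_add_smul_measure (f : C(X, ℝ)) (a b : ℝ≥0) (μ ν : Measure X)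
    [IsFiniteMeasure μ] [IsFiniteMeasure ν] :
    ∫ x, f x ∂((a : ℝ≥0∞) • μ + (b : ℝ≥0∞) • ν) = a * ∫ x, f x ∂μ + b * ∫ x, f x ∂ν := by
  rw [integral_add_measure
    ((f.integrable_of_isFiniteMeasure μ).smul_measure ENNReal.coe_ne_top)
    ((f.integrable_of_isFiniteMeasure ν).smul_measure ENNReal.coe_ne_top),
    integral_smul_measure, integral_smul_measure]
  simp

/-- Splitting off the comparable parts of two measures improves the asymptotic bound. -/
theorem EventuallyWithin.contract
    (hlin : ∀ (c₁ c₂ : ℝ≥0) (μ₁ μ₂ : Measure X), IsFiniteMeasure μ₁ → IsFiniteMeasure μ₂ →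
      P ((c₁ : ℝ≥0∞) • μ₁ + (c₂ : ℝ≥0∞) • μ₂) = (c₁ : ℝ≥0∞) • P μ₁ + (c₂ : ℝ≥0∞) • P μ₂)
    (hmass : ∀ μ : Measure X, IsFiniteMeasure μ → P μ Set.univ = μ Set.univ)
    {f : C(X, ℝ)} {δ C : ℝ} {a b : ℝ≥0} (hab : a + b = 1) (hb : b ≠ 0)
    (hlower : ∀ μ₁ μ₂ : Measure X, IsProbabilityMeasure μ₁ → IsProbabilityMeasure μ₂ →
      ∃ ν₁ ν₂ : Measure X, IsProbabilityMeasure ν₁ ∧ IsProbabilityMeasure ν₂ ∧ ∃ N : ℕ,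
        (a : ℝ≥0∞) • ν₁ ≤ P^[N] μ₁ ∧ (a : ℝ≥0∞) • ν₂ ≤ P^[N] μ₂ ∧
        ∀ᶠ n in atTop, |∫ x, f x ∂(P^[n] ν₁) - ∫ x, f x ∂(P^[n] ν₂)| ≤ δ)
    (hC : EventuallyWithin P f C) : EventuallyWithin P f (a * δ + b * C) := by
  intro μ₁ μ₂ h₁ h₂
  obtain ⟨ν₁, ν₂, hν₁, hν₂, N, hle₁, hle₂, hν⟩ := hlower μ₁ μ₂ h₁ h₂
  obtain ⟨ρ₁, hρ₁, e₁⟩ := exists_isProbabilityMeasure_eq_smul_add_smul hab hb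
    (isProbabilityMeasure_iterate hmass N h₁) hν₁ hle₁
  obtain ⟨ρ₂, hρ₂, e₂⟩ := exists_isProbabilityMeasure_eq_smul_add_smul hab hb
    (isProbabilityMeasure_iterate hmass N h₂) hν₂ hle₂
  suffices h : ∀ᶠ n in atTop,
      |∫ x, f x ∂(P^[n + N] μ₁) - ∫ x, f x ∂(P^[n + N] μ₂)| ≤ a * δ + b * C by
    rw [← map_add_atTop_eq_nat N]
    exact h
  filter_upwards [hν, hC ρ₁ ρ₂ hρ₁ hρ₂] with n hn hn'
  have := isProbabilityMeasure_iterate hmass n hν₁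
  have := isProbabilityMeasure_iterate hmass n hν₂
  have := isProbabilityMeasure_iterate hmass n hρ₁
  have := isProbabilityMeasure_iterate hmass n hρ₂
  rw [Function.iterate_add_apply, Function.iterate_add_apply, e₁, e₂,
    iterate_smul_add_smul hlin hmass n a b hν₁ hρ₁,
    iterate_smul_add_smul hlin hmass n a b hν₂ hρ₂,
    integral_smul_add_smul_measure, integral_smul_add_smul_measure]
  have ha0 : (0 : ℝ) ≤ a := a.2
  have hb0 : (0 : ℝ) ≤ b := b.2
  rw [abs_le] at hn hn' ⊢
  constructor <;>
    nlinarith [mul_le_mul_of_nonneg_left hn.1 ha0, mul_le_mul_of_nonneg_left hn.2 ha0,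
      mul_le_mul_of_nonneg_left hn'.1 hb0, mul_le_mul_of_nonneg_left hn'.2 hb0]

theorem EventuallyWithin.of_lower_bound
    (hlin : ∀ (c₁ c₂ : ℝ≥0) (μ₁ μ₂ : Measure X), IsFiniteMeasure μ₁ → IsFiniteMeasure μ₂ →
      P ((c₁ : ℝ≥0∞) • μ₁ + (c₂ : ℝ≥0∞) • μ₂) = (c₁ : ℝ≥0∞) • P μ₁ + (c₂ : ℝ≥0∞) • P μ₂)
    (hmass : ∀ μ : Measure X, IsFiniteMeasure μ → P μ Set.univ = μ Set.univ)
    {f : C(X, ℝ)} {ε α : ℝ} (hε : 0 < ε) (hα : 0 < α)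
    (hlower : ∀ μ₁ μ₂ : Measure X, IsProbabilityMeasure μ₁ → IsProbabilityMeasure μ₂ →
      ∃ ν₁ ν₂ : Measure X, IsProbabilityMeasure ν₁ ∧ IsProbabilityMeasure ν₂ ∧ ∃ N : ℕ,
        ENNReal.ofReal α • ν₁ ≤ P^[N] μ₁ ∧ ENNReal.ofReal α • ν₂ ≤ P^[N] μ₂ ∧
        limsup (fun n => |∫ x, f x ∂(P^[n] ν₁) - ∫ x, f x ∂(P^[n] ν₂)|) atTop ≤ ε) :
    EventuallyWithin P f (3 * ε) := by
  obtain ⟨a, b, ha, hab, hb, haα⟩ : ∃ a b : ℝ≥0, 0 < a ∧ a + b = 1 ∧ b ≠ 0 ∧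
      (a : ℝ≥0∞) ≤ ENNReal.ofReal α := by
    have hle : min α.toNNReal (1 / 2) < 1 := (min_le_right _ _).trans_lt (by norm_num)
    refine ⟨min α.toNNReal (1 / 2), 1 - min α.toNNReal (1 / 2), ?_,
      add_tsub_cancel_of_le hle.le, (tsub_pos_of_lt hle).ne', ?_⟩
    · exact lt_min (Real.toNNReal_pos.2 hα) (by norm_num)
    · exact ENNReal.coe_le_coe.2 (min_le_left _ _)
  have hlower' : ∀ μ₁ μ₂ : Measure X, IsProbabilityMeasure μ₁ → IsProbabilityMeasure μ₂ →
      ∃ ν₁ ν₂ : Measure X, IsProbabilityMeasure ν₁ ∧ IsProbabilityMeasure ν₂ ∧ ∃ N : ℕ,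
        (a : ℝ≥0∞) • ν₁ ≤ P^[N] μ₁ ∧ (a : ℝ≥0∞) • ν₂ ≤ P^[N] μ₂ ∧
        ∀ᶠ n in atTop, |∫ x, f x ∂(P^[n] ν₁) - ∫ x, f x ∂(P^[n] ν₂)| ≤ 2 * ε := by
    intro μ₁ μ₂ h₁ h₂
    obtain ⟨ν₁, ν₂, hν₁, hν₂, N, hle₁, hle₂, hlim⟩ := hlower μ₁ μ₂ h₁ h₂
    have hsmul (ν : Measure X) : (a : ℝ≥0∞) • ν ≤ ENNReal.ofReal α • ν :=
      Measure.le_iff.2 fun s _ => mul_le_mul_left haα (ν s)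
    refine ⟨ν₁, ν₂, hν₁, hν₂, N, (hsmul ν₁).trans hle₁, (hsmul ν₂).trans hle₂, ?_⟩
    have hbdd : IsBoundedUnder (· ≤ ·) atTop
        fun n => |∫ x, f x ∂(P^[n] ν₁) - ∫ x, f x ∂(P^[n] ν₂)| := by
      refine isBoundedUnder_of ⟨‖f‖ + ‖f‖, fun n => ?_⟩
      have := isProbabilityMeasure_iterate hmass n hν₁
      have := isProbabilityMeasure_iterate hmass n hν₂
      exact abs_integral_sub_integral_le f _ _
    exact (eventually_lt_of_limsup_lt (hlim.trans_lt (by linarith : ε < 2 * ε)) hbdd).mono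
      fun _ h => h.le
  have habR : (a : ℝ) + b = 1 := by exact_mod_cast hab
  have hpow (k : ℕ) :
      EventuallyWithin P f (2 * ε + (b : ℝ) ^ k * (‖f‖ + ‖f‖)) := by
    induction k with
    | zero =>
      intro μ₁ μ₂ h₁ h₂
      refine .of_forall fun n => ?_
      have := isProbabilityMeasure_iterate hmass n h₁
      have := isProbabilityMeasure_iterate hmass n h₂
      have := abs_integral_sub_integral_le f (P^[n] μ₁) (P^[n] μ₂)
      simp only [pow_zero, one_mul]
      linarith
    | succ k ih =>
      convert ih.contract hlin hmass hab hb hlower' using 1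
      rw [pow_succ]
      linear_combination (-2 * ε) * habR
  have hb1 : (b : ℝ) < 1 := by
    have : (0 : ℝ) < a := ha
    linarith
  have hlim : Tendsto (fun k : ℕ => (b : ℝ) ^ k * (‖f‖ + ‖f‖)) atTop (𝓝 0) := by
    simpa using (tendsto_pow_atTop_nhds_zero_of_lt_one b.2 hb1).mul_const (‖f‖ + ‖f‖)
  obtain ⟨k, hk⟩ := (hlim.eventually_lt_const hε).exists
  intro μ₁ μ₂ h₁ h₂
  filter_upwards [hpow k μ₁ μ₂ h₁ h₂] with n hn
  linarith

end MarkovOperator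

/-- A lower-bound criterion for asymptotic stability of an abstract Markov
operator `P` on finite Borel measures on the circle (a generalization of Doeblin's theorem). -/
theorem markov_operator_lower_bound_criterion (P : Measure S1 → Measure S1)
    (hlin : ∀ (c₁ c₂ : ℝ≥0) (μ₁ μ₂ : Measure S1), IsFiniteMeasure μ₁ → IsFiniteMeasure μ₂ →
      P ((c₁ : ℝ≥0∞) • μ₁ + (c₂ : ℝ≥0∞) • μ₂) = (c₁ : ℝ≥0∞) • P μ₁ + (c₂ : ℝ≥0∞) • P μ₂)
    (hmass : ∀ μ : Measure S1, IsFiniteMeasure μ → P μ Set.univ = μ Set.univ)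
    (hexist : ∃ μ : Measure S1, IsProbabilityMeasure μ ∧ P μ = μ)
    (hmain : ∀ ε : ℝ, 0 < ε → ∀ f : C(S1, ℝ), ∃ α : ℝ, 0 < α ∧
      ∀ μ₁ μ₂ : Measure S1, IsProbabilityMeasure μ₁ → IsProbabilityMeasure μ₂ →
        ∃ ν₁ ν₂ : Measure S1, IsProbabilityMeasure ν₁ ∧ IsProbabilityMeasure ν₂ ∧ ∃ N : ℕ,
          ENNReal.ofReal α • ν₁ ≤ P^[N] μ₁ ∧ ENNReal.ofReal α • ν₂ ≤ P^[N] μ₂ ∧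
          limsup (fun n => |∫ x, f x ∂(P^[n] ν₁) - ∫ x, f x ∂(P^[n] ν₂)|) atTop ≤ ε) :
    ∃ μs : Measure S1, IsProbabilityMeasure μs ∧ P μs = μs ∧
      (∀ ν : Measure S1, IsProbabilityMeasure ν → P ν = ν → ν = μs) ∧
      ∀ μ : Measure S1, IsProbabilityMeasure μ → ∀ f : C(S1, ℝ),
        Tendsto (fun n => ∫ x, f x ∂(P^[n] μ)) atTop (𝓝 (∫ x, f x ∂μs)) := by
  obtain ⟨μs, hμs, hinv⟩ := hexist
  have hlim : ∀ μ : Measure S1, IsProbabilityMeasure μ → ∀ f : C(S1, ℝ),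
      Tendsto (fun n => ∫ x, f x ∂(P^[n] μ)) atTop (𝓝 (∫ x, f x ∂μs)) := by
    intro μ hμ f
    rw [Metric.tendsto_nhds]
    intro ε hε
    have hε' : 0 < ε / 4 := by linarith
    obtain ⟨α, hα, hlower⟩ := hmain (ε / 4) hε' f
    filter_upwards [EventuallyWithin.of_lower_bound hlin hmass hε' hα hlower μ μs hμ hμs]
      with n hn
    rw [Function.iterate_fixed hinv] at hn
    rw [Real.dist_eq]
    linarith
  refine ⟨μs, hμs, hinv, fun ν hν hνinv => ?_, hlim⟩
  refine ext_of_forall_integral_eq_of_IsFiniteMeasure fun f => ?_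
  have h := hlim ν hν f.toContinuousMap
  simp only [Function.iterate_fixed hνinv] at h
  exact tendsto_nhds_unique tendsto_const_nhds h
end
end

section
/- Let Γ={g₁,…,g_k} be a finite admissible set of orientation-preserving circle homeomorphisms whose action is contractive. Then for every n∈ℕ there exists τ>0 such that for all x,y∈S¹ there exist N∈ℕ, words w₁,…,w_n and v₁,…,v_n, all of length N, and real numbers a₁<b₁<a₂<b₂<⋯<a_n<b_n<a₁+1 with π(a_m)=g_{w_m}(x) and π(b_m)=g_{v_m}(y) for m=1,…,n, satisfying b_m−a_m ≥ τ for all m=1,…,n and a_{m+1}−b_m ≥ τ for all m=1,…,n−1 (where π:ℝ→S¹ is the quotient map). -/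
open MeasureTheory Filter Topology

noncomputable section

section

open Function Set

instance nontrivial_S1 : Nontrivial S1 := by
  refine ⟨⟨((1 / 2 : ℝ) : S1), 0, fun h => ?_⟩⟩
  obtain ⟨n, hn⟩ := (AddCircle.coe_eq_zero_iff _).1 h
  have h2 : ((2 * n : ℤ) : ℝ) = (1 : ℤ) := by
    rw [zsmul_one] at hn
    push_cast
    linarith
  have := Int.cast_injective h2
  omega

theorem dense_iterate_tail {T : S1 → S1} {x : S1}
    (h : Dense (Set.range fun n : ℕ => T^[n + 1] x)) (M : ℕ) :
    Dense ((fun n : ℕ => T^[n] x) '' Ici M) := by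
  refine (h.sdiff_finite (((finite_Iio M).image fun n : ℕ => T^[n] x))).mono ?_
  rintro _ ⟨⟨n, rfl⟩, hn⟩
  refine ⟨n + 1, ?_, rfl⟩
  by_contra hlt
  exact hn ⟨n + 1, by simpa using hlt, rfl⟩

theorem not_isPeriodicPt_of_dense {T : S1 → S1} {x : S1}
    (h : ∀ M : ℕ, Dense ((fun n : ℕ => T^[n] x) '' Ici M)) {q : ℕ} (hq : 0 < q) :
    ¬ IsPeriodicPt T q x := by
  intro hper
  have hfin : ((fun n : ℕ => T^[n] x) '' Ici 0).Finite := by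
    refine ((finite_Iio q).image fun n : ℕ => T^[n] x).subset ?_
    rintro _ ⟨n, -, rfl⟩
    exact ⟨n % q, Nat.mod_lt _ hq, hper.iterate_mod_apply n⟩
  have huniv := hfin.isClosed.closure_eq ▸ (h 0).closure_eq
  have : Infinite S1 := infinite_univ_iff.1
    (isPreconnected_univ.infinite_of_nontrivial nontrivial_univ)
  exact infinite_univ (huniv ▸ hfin)

theorem lift_iterate {T : S1 → S1} {f : CircleDeg1Lift} (hf : ∀ t : ℝ, T (t : S1) = (f t : ℝ))
    (n : ℕ) (t : ℝ) : T^[n] (t : S1) = (f^[n] t : ℝ) :=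
  ((show Semiconj ((↑) : ℝ → S1) f T from fun t => (hf t).symm).iterate_right n t).symm

theorem exists_lift_iterate_mem_Ioo {T : S1 → S1} {f : CircleDeg1Lift} {y : ℝ}
    (hf : ∀ t : ℝ, T (t : S1) = (f t : ℝ))
    (h : ∀ M : ℕ, Dense ((fun n : ℕ => T^[n] (y : S1)) '' Ici M)) (M : ℕ) {u v : ℝ}
    (huv : u < v) : ∃ n ≥ M, ∃ m : ℤ, f^[n] y + m ∈ Ioo u v := by
  obtain ⟨_, ⟨n, hn, rfl⟩, t, ht, htn⟩ := (h M).exists_mem_open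
    (QuotientAddGroup.isOpenMap_coe (N := AddSubgroup.zmultiples (1 : ℝ)) (Ioo u v) isOpen_Ioo)
    ((nonempty_Ioo.2 huv).image _)
  have h0 : ((t - f^[n] y : ℝ) : S1) = 0 := by
    rw [AddCircle.coe_sub, ← lift_iterate hf n y, sub_eq_zero]
    exact htn
  obtain ⟨m, hm⟩ := AddCircle.coe_eq_zero_iff _ |>.1 h0
  refine ⟨n, hn, m, ?_⟩
  have : f^[n] y + m = t := by
    rw [zsmul_one] at hm
    linarith
  rwa [this]

theorem map_iterate_of_semiconj {F f : CircleDeg1Lift} {τ : ℝ} (hF : ∀ t, F (f t) = τ + F t)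
    (n : ℕ) (t : ℝ) : F (f^[n] t) = F t + n * τ := by
  induction n with
  | zero => simp
  | succ n ih => rw [iterate_succ_apply', hF, ih]; push_cast; ring

theorem irrational_of_dense_orbit {T : S1 → S1} {F f : CircleDeg1Lift} {y τ : ℝ}
    (hmono : StrictMono f)
    (hf : ∀ t : ℝ, T (t : S1) = (f t : ℝ))
    (h : ∀ M : ℕ, Dense ((fun n : ℕ => T^[n] (y : S1)) '' Ici M))
    (hF : ∀ t, F (f t) = τ + F t) : Irrational τ := by
  rintro ⟨r, hr⟩
  set p := r.num
  set q := r.den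
  have hq : 0 < q := r.den_pos
  have hqR : (0 : ℝ) < q := by exact_mod_cast hq
  have hτ : (q : ℝ) * τ = p := by
    rw [← hr]
    exact_mod_cast r.den_mul_eq_num
  have hFq : F (f^[q] y - p) = F y := by
    rw [CircleDeg1Lift.map_sub_int, map_iterate_of_semiconj hF, hτ]; ring
  have key : ∀ (d : ℕ) (m : ℤ), F (f^[q + d] y + m) = F y → (d : ℤ) * p = q * (-m - p) := by
    intro d m hdm
    rw [CircleDeg1Lift.map_add_int, map_iterate_of_semiconj hF] at hdm
    have h1 : ((q + d : ℕ) : ℝ) * τ = -m := by linarith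
    have h2 : ((d : ℤ) * p : ℝ) = q * (-m - p) := by
      rw [← hτ]
      push_cast at h1 ⊢
      linear_combination (q : ℝ) * h1
    exact_mod_cast h2
  have shift : ∀ (d : ℕ) (m : ℤ), f^[q + d] y + m + p = f^[q] (f^[d] y + (m + p : ℤ)) := by
    intro d m
    rw [← CircleDeg1Lift.coe_pow, ← CircleDeg1Lift.coe_pow, CircleDeg1Lift.map_add_int,
      CircleDeg1Lift.coe_pow, CircleDeg1Lift.coe_pow, iterate_add_apply]
    push_cast; ring
  have comm : ∀ d : ℕ, (f ^ d)^[q] y = (f ^ q)^[d] y := by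
    intro d
    rw [CircleDeg1Lift.coe_pow, CircleDeg1Lift.coe_pow, ← iterate_mul, ← iterate_mul, mul_comm]
  rcases lt_trichotomy (f^[q] y) (y + p) with hlt | heq | hgt
  · obtain ⟨n, hn, m, hm1, hm2⟩ := exists_lift_iterate_mem_Ioo hf h q
      (show f^[q] y - p < y by linarith)
    obtain ⟨d, rfl⟩ := Nat.exists_eq_add_of_le hn
    have hd := key d m (le_antisymm (F.monotone hm2.le) (hFq ▸ F.monotone hm1.le))
    have h1 : f^[q] y < f^[q] (f^[d] y + (m + p : ℤ)) := by rw [← shift]; linarith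
    have h2 : y + (-m - p : ℤ) < (f ^ d) y := by
      have := (hmono.iterate q).lt_iff_lt.1 h1
      rw [CircleDeg1Lift.coe_pow]
      push_cast at this ⊢
      linarith
    have h3 := ((f ^ d).lt_iterate_pos_iff hq).2 h2
    have h4 := (f ^ q).iterate_le_of_map_le_add_int (x := y) (m := p)
      (by rw [CircleDeg1Lift.coe_pow]; exact hlt.le) d
    rw [comm] at h3
    have h5 : (d : ℝ) * p = q * (-m - p : ℤ) := by exact_mod_cast hd
    linarith
  · refine not_isPeriodicPt_of_dense h hq ?_
    rw [IsPeriodicPt, IsFixedPt, lift_iterate hf, heq, AddCircle.coe_add, add_eq_left]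
    exact (AddCircle.coe_eq_zero_iff _).2 ⟨p, by simp⟩
  · obtain ⟨n, hn, m, hm1, hm2⟩ := exists_lift_iterate_mem_Ioo hf h q
      (show y < f^[q] y - p by linarith)
    obtain ⟨d, rfl⟩ := Nat.exists_eq_add_of_le hn
    have hd := key d m (le_antisymm (hFq ▸ F.monotone hm2.le) (F.monotone hm1.le))
    have h1 : f^[q] (f^[d] y + (m + p : ℤ)) < f^[q] y := by rw [← shift]; linarith
    have h2 : (f ^ d) y < y + (-m - p : ℤ) := by
      have := (hmono.iterate q).lt_iff_lt.1 h1
      rw [CircleDeg1Lift.coe_pow]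
      push_cast at this ⊢
      linarith
    have h3 := ((f ^ d).iterate_pos_lt_iff hq).2 h2
    have h4 := (f ^ q).le_iterate_of_add_int_le_map (x := y) (m := p)
      (by rw [CircleDeg1Lift.coe_pow]; exact hgt.le) d
    rw [comm] at h3
    have h5 : (d : ℝ) * p = q * (-m - p : ℤ) := by exact_mod_cast hd
    linarith

theorem injective_of_dense_orbit {T : S1 → S1} {F f : CircleDeg1Lift} {y τ : ℝ}
    (hf : ∀ t : ℝ, T (t : S1) = (f t : ℝ))
    (h : ∀ M : ℕ, Dense ((fun n : ℕ => T^[n] (y : S1)) '' Ici M))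
    (hF : ∀ t, F (f t) = τ + F t) (hτ : Irrational τ) : Injective F := by
  intro a b hab
  by_contra hne
  wlog hlt : a < b generalizing a b
  · exact this hab.symm (Ne.symm hne) (lt_of_le_of_ne (not_lt.1 hlt) (Ne.symm hne))
  have key : ∀ (n : ℕ) (m : ℤ), f^[n] y + m ∈ Ioo a b → F y + n * τ + m = F a := by
    intro n m hm
    rw [← map_iterate_of_semiconj hF, ← CircleDeg1Lift.map_add_int]
    exact le_antisymm (hab ▸ F.monotone hm.2.le) (F.monotone hm.1.le)
  obtain ⟨n₁, -, m₁, h₁⟩ := exists_lift_iterate_mem_Ioo hf h 0 hlt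
  obtain ⟨n₂, hn, m₂, h₂⟩ := exists_lift_iterate_mem_Ioo hf h (n₁ + 1) hlt
  have h3 := (key n₁ m₁ h₁).trans (key n₂ m₂ h₂).symm
  have hne : ((n₂ : ℤ) - n₁) ≠ 0 := by omega
  refine (hτ.intCast_mul hne).ne_int (m₁ - m₂) ?_
  push_cast
  linarith

theorem continuous_of_semiconj_irrational {F : CircleDeg1Lift} {f : CircleDeg1Liftˣ} {τ : ℝ}
    (hF : ∀ t, F (f t) = τ + F t) (hτ : Irrational τ) : Continuous F := by
  refine F.monotone.continuous_of_denseRange ?_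
  have hdense : Dense (AddSubgroup.closure {τ, 1} : Set ℝ) :=
    dense_addSubgroupClosure_pair_iff.2 (by simpa using hτ)
  have key : ∀ s ∈ AddSubgroup.closure {τ, (1 : ℝ)}, ∀ t,
      F t + s ∈ range F ∧ F t - s ∈ range F := by
    intro s hs
    induction hs using AddSubgroup.closure_induction with
    | mem s hs =>
      intro t
      rcases hs with rfl | rfl
      · refine ⟨⟨f t, by rw [hF, add_comm]⟩, f⁻¹ t, ?_⟩
        rw [eq_sub_iff_add_eq', ← hF, CircleDeg1Lift.units_apply_inv_apply]
      · exact ⟨⟨t + 1, F.map_add_one t⟩, t - 1, by simpa using F.map_sub_int t 1⟩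
    | zero => exact fun t => by simp
    | add a b _ _ ha hb =>
      intro t
      obtain ⟨⟨u, hu⟩, v, hv⟩ := ha t
      rw [← add_assoc, ← hu, ← sub_sub, ← hv]
      exact ⟨(hb u).1, (hb v).2⟩
    | neg a _ ha =>
      intro t
      rw [sub_neg_eq_add, ← sub_eq_add_neg]
      exact (ha t).symm
  have := (Homeomorph.addLeft (F 0)).surjective.denseRange.dense_image
    (Homeomorph.addLeft (F 0)).continuous hdense
  refine this.mono ?_
  rintro _ ⟨s, hs, rfl⟩
  exact (key s hs 0).1

theorem exists_homeomorph_of_lift {F : CircleDeg1Lift} (hc : Continuous F) (hi : Injective F) :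
    ∃ Φ : S1 ≃ₜ S1, ∀ t : ℝ, Φ (t : S1) = (F t : ℝ) := by
  have hper : Periodic (fun t => ((F t : ℝ) : S1)) 1 := fun t => by
    simp only [F.map_add_one, AddCircle.coe_add_period]
  have hcont : Continuous (hper.lift : S1 → S1) :=
    continuous_quot_lift _ ((AddCircle.continuous_mk' 1).comp hc)
  have hbij : Bijective (hper.lift : S1 → S1) := by
    constructor
    · intro s t
      induction s using QuotientAddGroup.induction_on with | H s =>
      induction t using QuotientAddGroup.induction_on with | H t =>
      intro hst
      have h0 : ((F s - F t : ℝ) : S1) = 0 := by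
        rw [AddCircle.coe_sub, sub_eq_zero]
        exact hst
      obtain ⟨n, hn⟩ := (AddCircle.coe_eq_zero_iff _).1 h0
      rw [zsmul_one] at hn
      have : s = t + n := hi (by rw [F.map_add_int]; linarith)
      rw [← sub_eq_zero]
      refine (AddCircle.coe_eq_zero_iff (p := (1 : ℝ)) (x := s - t)).2 ⟨n, ?_⟩
      rw [zsmul_one]
      linarith
    · intro t
      induction t using QuotientAddGroup.induction_on with | H t =>
      obtain ⟨s, rfl⟩ := F.continuous_iff_surjective.1 hc t
      exact ⟨(s : S1), rfl⟩
  exact ⟨Continuous.homeoOfEquivCompactToT2 (f := Equiv.ofBijective _ hbij) hcont, fun t => rfl⟩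

/-- A circle homeomorphism with a dense forward orbit is conjugate to a rotation. -/
theorem exists_conj_rotation {T : S1 ≃ₜ S1} (hT : IsOPH T) {x : S1}
    (hx : ∀ M : ℕ, Dense ((fun n : ℕ => (⇑T)^[n] x) '' Ici M)) :
    ∃ (Φ : S1 ≃ₜ S1) (α : S1), ∀ z, Φ (T z) = Φ z + α := by
  obtain ⟨G, hmono, hcont, hG1, hGT⟩ := hT
  obtain ⟨y, rfl⟩ := QuotientAddGroup.mk_surjective x
  let f : CircleDeg1Lift := ⟨⟨G, hmono.monotone⟩, hG1⟩
  have hsurj : Surjective f := f.continuous_iff_surjective.1 hcont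
  obtain ⟨u, hu⟩ := CircleDeg1Lift.isUnit_iff_bijective.2 ⟨hmono.injective, hsurj⟩
  obtain ⟨F, hF⟩ := CircleDeg1Lift.semiconj_of_isUnit_of_translationNumber_eq
    (f₁ := f)
    (f₂ := CircleDeg1Lift.translate (Multiplicative.ofAdd f.translationNumber))
    ⟨u, hu⟩ (Units.isUnit _) (CircleDeg1Lift.translationNumber_translate _).symm
  have hF' : ∀ t, F (f t) = f.translationNumber + F t := fun t => hF t
  have hirr := irrational_of_dense_orbit hmono hGT hx hF'
  have hinj := injective_of_dense_orbit hGT hx hF' hirr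
  obtain ⟨Φ, hΦ⟩ := exists_homeomorph_of_lift
    (continuous_of_semiconj_irrational (f := u) (fun t => by rw [hu]; exact hF' t) hirr) hinj
  refine ⟨Φ, (f.translationNumber : ℝ), fun z => ?_⟩
  obtain ⟨t, rfl⟩ := QuotientAddGroup.mk_surjective z
  calc Φ (T (t : S1)) = Φ ((f t : ℝ) : S1) := by rw [hGT]; rfl
    _ = ((f.translationNumber + F t : ℝ) : S1) := by rw [hΦ, hF']
    _ = Φ (t : S1) + (f.translationNumber : ℝ) := by rw [hΦ, AddCircle.coe_add, add_comm]

/-- A nonempty closed subset of the circle that is stable under translations by the elements of a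
nontrivial connected set is everything. -/
theorem eq_univ_of_add_connected {C D : Set S1} (hC : IsClosed C) (hne : C.Nonempty)
    (hD : IsPreconnected D) (hD' : D.Nontrivial) (hCD : ∀ p ∈ C, ∀ d ∈ D, p + d ∈ C) :
    C = univ := by
  have hinf := hD.infinite_of_nontrivial hD'
  have hdense : Dense (AddSubgroup.closure D : Set S1) := by
    refine AddCircle.dense_addSubgroup_iff_ne_zmultiples.2 fun a ha heq => ?_
    refine hinf (Finite.subset (s := (AddSubgroup.zmultiples a : Set S1)) ?_ ?_)
    · exact (finite_zmultiples.2 (addOrderOf_pos_iff.1 (Nat.pos_of_ne_zero ha)))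
    · rw [← heq]
      exact AddSubgroup.subset_closure
  rw [← dense_addSubmonoidClosure_iff_addSubgroupClosure] at hdense
  have hstab : ∀ s ∈ AddSubmonoid.closure D, ∀ p ∈ C, p + s ∈ C := by
    intro s hs
    induction hs using AddSubmonoid.closure_induction with
    | mem d hd => exact fun p hp => hCD p hp d hd
    | zero => simp
    | add a b _ _ ha hb => exact fun p hp => by rw [← add_assoc]; exact hb _ (ha p hp)
  obtain ⟨p, hp⟩ := hne
  refine hC.closure_eq ▸ Dense.closure_eq ?_
  refine ((Homeomorph.addLeft p).surjective.denseRange.dense_image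
    (Homeomorph.addLeft p).continuous hdense).mono ?_
  rintro _ ⟨s, hs, rfl⟩
  exact hstab s hs p hp

section Words

variable {k : ℕ} {g : Fin k → S1 ≃ₜ S1}

theorem applyWord_append (v w : List (Fin k)) (x : S1) :
    applyWord g (v ++ w) x = applyWord g w (applyWord g v x) :=
  List.foldl_append

theorem map_applyWord_append_replicate {Φ : S1 ≃ₜ S1} {α : S1} {i₀ : Fin k}
    (hΦ : ∀ z, Φ (g i₀ z) = Φ z + α) (w : List (Fin k)) (n : ℕ) (x : S1) :
    Φ (applyWord g (w ++ List.replicate n i₀) x) = Φ (applyWord g w x) + n • α := by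
  induction n with
  | zero => simp
  | succ n ih =>
    rw [List.replicate_succ', ← List.append_assoc, applyWord_append, succ_nsmul, ← add_assoc, ← ih]
    exact hΦ _

/-- A contractive action is not conjugate to an action by rotations. -/
theorem Contractive.not_forall_rotation (hcontr : Contractive g) (Φ : S1 ≃ₜ S1) :
    ¬ ∀ i, ∃ β : S1, ∀ z, Φ (g i z) = Φ z + β := by
  intro hrot
  have hword : ∀ w : List (Fin k), ∃ β : S1, ∀ z, Φ (applyWord g w z) = Φ z + β := by
    intro w
    induction w with
    | nil => exact ⟨0, fun z => by simp [applyWord]⟩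
    | cons i w ih =>
      obtain ⟨β, hβ⟩ := ih
      obtain ⟨γ, hγ⟩ := hrot i
      exact ⟨γ + β, fun z => by rw [← add_assoc, ← hγ]; exact hβ _⟩
  obtain ⟨a, b, -, -, h0, w, hw⟩ := hcontr 0
  set A : Set S1 := (fun t : ℝ => (t : S1)) '' Ioo a b
  have hA : IsOpen A :=
    QuotientAddGroup.isOpenMap_coe (N := AddSubgroup.zmultiples (1 : ℝ)) _ isOpen_Ioo
  obtain ⟨r, hr, hball⟩ := Metric.isOpen_iff.1 (Φ.isOpenMap A hA) (Φ 0) (mem_image_of_mem _ h0)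
  choose β hβ using fun m => hword (w m)
  obtain ⟨β', -, φ, hφ, hlim⟩ := isCompact_univ.tendsto_subseq fun m => mem_univ (β m)
  set U : Set S1 := Φ ⁻¹' Metric.ball (Φ 0 + β') (r / 2)
  have hU : 0 < volume U := by
    refine (Metric.isOpen_ball.preimage Φ.continuous).measure_pos _ ⟨Φ.symm (Φ 0 + β'), ?_⟩
    simp [hr]
  refine hU.not_ge (ge_of_tendsto (hw.comp hφ.tendsto_atTop) ?_)
  filter_upwards [Metric.tendsto_nhds.1 hlim (r / 2) (half_pos hr)] with m hm
  refine measure_mono fun z hz => ?_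
  have hz' : Φ z - β (φ m) ∈ Metric.ball (Φ 0) r := by
    have h1 : dist (Φ z) (Φ 0 + β') < r / 2 := hz
    have h2 : dist (Φ 0 + β') (Φ 0 + β (φ m)) < r / 2 := by
      rw [dist_add_left, dist_comm]
      exact hm
    rw [Metric.mem_ball, ← dist_add_right _ _ (β (φ m)), sub_add_cancel]
    linarith [dist_triangle (Φ z) (Φ 0 + β') (Φ 0 + β (φ m))]
  obtain ⟨y, hy, hyz⟩ := hball hz'
  refine ⟨y, hy, Φ.injective ?_⟩
  rw [hβ, hyz, sub_add_cancel]

variable {Φ : S1 ≃ₜ S1} {α : S1} {i₀ : Fin k}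

/-- In the rotating frame of `g i₀`, the images of a point under all words are dense as soon as
some generator is not a rotation. -/
theorem dense_rotating_frame (hΦ : ∀ z, Φ (g i₀ z) = Φ z + α)
    (hα : ∀ (p : S1) (M : ℕ), Dense ((fun n : ℕ => p + n • α) '' Ici M))
    {i : Fin k} (hi : ¬ ∃ β : S1, ∀ z, Φ (g i z) = Φ z + β) (x : S1) :
    Dense {p : S1 | ∃ w : List (Fin k), Φ (applyWord g w x) = p + w.length • α} := by
  set V := {p : S1 | ∃ w : List (Fin k), Φ (applyWord g w x) = p + w.length • α}
  let φ : S1 → S1 := fun s => Φ (g i (Φ.symm s)) - s - α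
  have hφ : Continuous φ := by fun_prop
  have hstep : ∀ p ∈ V, ∀ s, p + φ s ∈ closure V := by
    rintro p ⟨w, hw⟩ s
    refine map_mem_closure (f := fun s => p + φ s) (by fun_prop) (hα p w.length s) ?_
    rintro _ ⟨n, hn, rfl⟩
    obtain ⟨d, rfl⟩ := Nat.exists_eq_add_of_le (mem_Ici.1 hn)
    refine ⟨w ++ List.replicate d i₀ ++ [i], ?_⟩
    have h1 : Φ.symm (p + (w.length + d) • α) = applyWord g (w ++ List.replicate d i₀) x := by
      rw [Φ.symm_apply_eq, map_applyWord_append_replicate hΦ, hw, add_nsmul, add_assoc]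
    rw [applyWord_append]
    simp only [φ, h1, List.length_append, List.length_replicate, List.length_singleton,
      succ_nsmul]
    change Φ (g i _) = _
    abel
  have huniv : closure V = univ := by
    refine eq_univ_of_add_connected isClosed_closure ⟨Φ x, subset_closure ⟨[], by simp [applyWord]⟩⟩
      (isPreconnected_range hφ) ?_ ?_
    · by_contra hsub
      rw [not_nontrivial_iff] at hsub
      refine hi ⟨φ 0 + α, fun z => ?_⟩
      rw [hsub (mem_range_self 0) (mem_range_self (Φ z))]
      simp [φ]
    · rintro p hp _ ⟨s, rfl⟩
      have := map_mem_closure (f := fun p => p + φ s) (by fun_prop) hp fun p hp => hstep p hp s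
      rwa [closure_closure] at this
  exact dense_iff_closure_eq.2 huniv

theorem eventually_exists_word_mem_conj (hΦ : ∀ z, Φ (g i₀ z) = Φ z + α)
    (hα : ∀ (p : S1) (M : ℕ), Dense ((fun n : ℕ => p + n • α) '' Ici M))
    {i : Fin k} (hi : ¬ ∃ β : S1, ∀ z, Φ (g i z) = Φ z + β) (x : S1) {U : Set S1}
    (hU : IsOpen U) (hne : U.Nonempty) :
    ∀ᶠ N in atTop, ∃ w : List (Fin k), w.length = N ∧ applyWord g w x ∈ U := by
  obtain ⟨c, hc⟩ := hne
  obtain ⟨r, hr, hball⟩ := Metric.isOpen_iff.1 (Φ.isOpenMap U hU) (Φ c) (mem_image_of_mem _ hc)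
  let O : List (Fin k) → Set S1 := fun w =>
    Metric.ball (Φ (applyWord g w x) - w.length • α) r
  obtain ⟨t, ht⟩ := isCompact_univ.elim_finite_subcover O (fun _ => Metric.isOpen_ball) (by
    intro z _
    obtain ⟨p, ⟨w, hw⟩, hp⟩ := (dense_rotating_frame hΦ hα hi x).exists_dist_lt z hr
    refine mem_iUnion.2 ⟨w, ?_⟩
    simpa [O, hw] using hp)
  filter_upwards [eventually_ge_atTop (t.sup List.length)] with N hN
  obtain ⟨w, hwt, hw⟩ := mem_iUnion₂.1 (ht (mem_univ (Φ c - N • α)))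
  obtain ⟨d, rfl⟩ := Nat.exists_eq_add_of_le ((Finset.le_sup (f := List.length) hwt).trans hN)
  refine ⟨w ++ List.replicate d i₀, by simp, ?_⟩
  have : Φ (applyWord g (w ++ List.replicate d i₀) x) ∈ Metric.ball (Φ c) r := by
    have hw' : dist (Φ c - (w.length + d) • α) (Φ (applyWord g w x) - w.length • α) < r := hw
    rw [map_applyWord_append_replicate hΦ, Metric.mem_ball, dist_comm]
    rw [← dist_add_right _ _ ((w.length + d) • α), sub_add_cancel] at hw'
    convert hw' using 2
    rw [add_nsmul]
    abel
  exact (Φ.injective.mem_set_image).1 (hball this)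

/-- For an admissible contractive family, the images of any point under words of length `N` meet
a given nonempty open set for all large `N`. -/
theorem eventually_exists_word_mem (hg : ∀ i, IsOPH (g i)) (hadm : Admissible g)
    (hcontr : Contractive g) (x : S1) {U : Set S1} (hU : IsOpen U) (hne : U.Nonempty) :
    ∀ᶠ N in atTop, ∃ w : List (Fin k), w.length = N ∧ applyWord g w x ∈ U := by
  obtain ⟨i₀, y, hy⟩ := hadm
  have hy' := dense_iterate_tail hy
  obtain ⟨Φ, α, hΦ⟩ := exists_conj_rotation (hg i₀) hy'
  obtain ⟨i, hi⟩ := not_forall.1 (hcontr.not_forall_rotation Φ)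
  refine eventually_exists_word_mem_conj hΦ (fun p M => ?_) hi x hU hne
  have hiter : ∀ n : ℕ, Φ ((g i₀)^[n] y) = Φ y + n • α := by
    intro n
    induction n with
    | zero => simp
    | succ n ih => rw [iterate_succ_apply', hΦ, ih, succ_nsmul, add_assoc]
  let Ψ : S1 ≃ₜ S1 := Φ.trans (Homeomorph.addLeft (p - Φ y))
  refine (Ψ.surjective.denseRange.dense_image Ψ.continuous (hy' M)).mono ?_
  rintro _ ⟨_, ⟨n, hn, rfl⟩, rfl⟩
  refine ⟨n, hn, ?_⟩
  simp only [Ψ, Homeomorph.trans_apply, Homeomorph.coe_addLeft, hiter]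
  abel

end Words

end

/-- For an admissible contractive family: for every `n` there is `τ > 0`
(independent of `x, y`) such that for all `x, y` one can find words `w₁,…,w_n, v₁,…,v_n` of a
common length `N` whose images of `x` and `y` interleave
`g_{w₁}(x) < g_{v₁}(y) < ⋯ < g_{w_n}(x) < g_{v_n}(y)` around the circle, with all consecutive
gaps at least `τ`. -/
theorem interleaving_images_with_uniform_gaps {k : ℕ} (g : Fin k → S1 ≃ₜ S1)
    (hg : ∀ i, IsOPH (g i)) (hadm : Admissible g) (hcontr : Contractive g) (n : ℕ) :
    ∃ τ : ℝ, 0 < τ ∧ ∀ x y : S1, ∃ N : ℕ, ∃ w v : ℕ → List (Fin k), ∃ a b : ℕ → ℝ,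
      (∀ m < n, (w m).length = N ∧ (v m).length = N) ∧
      (∀ m < n, ((a m : ℝ) : S1) = applyWord g (w m) x ∧ ((b m : ℝ) : S1) = applyWord g (v m) y) ∧
      (∀ m < n, a m < b m ∧ τ ≤ b m - a m) ∧
      (∀ m, m + 1 < n → b m < a (m + 1) ∧ τ ≤ a (m + 1) - b m) ∧
      (1 ≤ n → b (n - 1) < a 0 + 1) := by
  rcases Nat.eq_zero_or_pos n with rfl | hn
  · exact ⟨1, one_pos, fun x y => ⟨0, fun _ => [], fun _ => [], 0, 0, by simp⟩⟩
  set τ : ℝ := 1 / (4 * n) with hτdef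
  have hnR : (0 : ℝ) < n := by exact_mod_cast hn
  have hτ : 0 < τ := by positivity
  have hnτ : 4 * n * τ = 1 := by rw [hτdef]; field_simp
  refine ⟨τ, hτ, fun x y => ?_⟩
  have hmeet : ∀ (z : S1) (j : ℕ), ∀ᶠ N in atTop, ∃ w : List (Fin k), w.length = N ∧
      ∃ t ∈ Set.Ioo (j * τ) ((j + 1) * τ), ((t : ℝ) : S1) = applyWord g w z := by
    intro z j
    exact eventually_exists_word_mem hg hadm hcontr z
      (QuotientAddGroup.isOpenMap_coe (N := AddSubgroup.zmultiples (1 : ℝ))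
        (Set.Ioo (j * τ) ((j + 1) * τ)) isOpen_Ioo)
      ((Set.nonempty_Ioo.2 (by nlinarith)).image _)
  obtain ⟨N, hN⟩ := ((eventually_all_finite (Set.finite_Iio (4 * n))).2 fun j _ =>
    (hmeet x j).and (hmeet y j)).exists
  have hx : ∀ m, ∃ w : List (Fin k), ∃ t : ℝ, m < n → w.length = N ∧
      t ∈ Set.Ioo (((4 * m : ℕ) : ℝ) * τ) (((4 * m : ℕ) + 1) * τ) ∧
      ((t : ℝ) : S1) = applyWord g w x := by
    intro m
    by_cases hm : m < n
    · obtain ⟨w, hw, t, ht, htw⟩ := (hN (4 * m) (Set.mem_Iio.2 (by omega))).1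
      exact ⟨w, t, fun _ => ⟨hw, ht, htw⟩⟩
    · exact ⟨[], 0, fun h => absurd h hm⟩
  have hy : ∀ m, ∃ w : List (Fin k), ∃ t : ℝ, m < n → w.length = N ∧
      t ∈ Set.Ioo (((4 * m + 2 : ℕ) : ℝ) * τ) (((4 * m + 2 : ℕ) + 1) * τ) ∧
      ((t : ℝ) : S1) = applyWord g w y := by
    intro m
    by_cases hm : m < n
    · obtain ⟨w, hw, t, ht, htw⟩ := (hN (4 * m + 2) (Set.mem_Iio.2 (by omega))).2
      exact ⟨w, t, fun _ => ⟨hw, ht, htw⟩⟩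
    · exact ⟨[], 0, fun h => absurd h hm⟩
  choose w a hwa using hx
  choose v b hvb using hy
  have ha : ∀ m < n, 4 * m * τ < a m ∧ a m < 4 * m * τ + τ := fun m hm => by
    have := (hwa m hm).2.1
    push_cast at this
    exact ⟨this.1, by linarith [this.2]⟩
  have hb : ∀ m < n, 4 * m * τ + 2 * τ < b m ∧ b m < 4 * m * τ + 3 * τ := fun m hm => by
    have := (hvb m hm).2.1
    push_cast at this
    exact ⟨by linarith [this.1], by linarith [this.2]⟩
  refine ⟨N, w, v, a, b, fun m hm => ⟨(hwa m hm).1, (hvb m hm).1⟩,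
    fun m hm => ⟨(hwa m hm).2.2, (hvb m hm).2.2⟩, fun m hm => ?_, fun m hm => ?_, fun _ => ?_⟩
  · have h1 := ha m hm
    have h2 := hb m hm
    constructor <;> linarith
  · have h1 := ha (m + 1) hm
    have h2 := hb m (by omega)
    push_cast at h1
    constructor <;> linarith
  · have h1 := ha 0 hn
    have h2 := hb (n - 1) (by omega)
    rw [Nat.cast_sub hn] at h2
    push_cast at h1 h2
    linarith
end
end

section
/- Let Γ={g₁,…,g_k} be a finite admissible set of orientation-preserving circle homeomorphisms whose action is contractive, let p=(p₁,…,p_k) be a probability vector with all pᵢ>0, and let P be the associated Markov operator. For each K∈ℕ let points x₁^K,y₁^K,…,x_K^K,y_K^K∈S¹ be given which are interleaved in cyclic order (there exist reals t₁<s₁<t₂<s₂<⋯<t_K<s_K<t₁+1 with π(t_j)=x_j^K, π(s_j)=y_j^K), and let μ₁^K be the uniform probability measure on {x₁^K,…,x_K^K} and μ₂^K the uniform probability measure on {y₁^K,…,y_K^K}. Then for every continuous f:S¹→ℝ, lim_{K→∞} limsup_{n→∞} |∫ f d(Pⁿμ₁^K) − ∫ f d(Pⁿμ₂^K)| = 0.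 -/
open MeasureTheory Filter Topology

noncomputable section

open scoped ENNReal

/-- The real points `t 0 < s 0 < t 1 < ⋯ < t K < s K < t 0 + 1` are lifts of two families of
`K + 1` points interleaving on the circle. -/
def Interleaved (K : ℕ) (t s : ℕ → ℝ) : Prop :=
  (∀ j ≤ K, t j < s j) ∧ (∀ j < K, s j < t (j + 1)) ∧ s K < t 0 + 1

lemma Interleaved.comp {K : ℕ} {t s : ℕ → ℝ} (h : Interleaved K t s) {G : ℝ → ℝ}
    (hG : StrictMono G) (hG1 : ∀ x, G (x + 1) = G x + 1) :
    Interleaved K (G ∘ t) (G ∘ s) :=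
  ⟨fun j hj => hG (h.1 j hj), fun j hj => hG (h.2.1 j hj), by
    simpa [hG1] using hG h.2.2⟩

lemma Interleaved.sum_sub_le_one {K : ℕ} {t s : ℕ → ℝ} (h : Interleaved K t s) :
    ∑ j ∈ Finset.range (K + 1), (s j - t j) ≤ 1 := by
  have key : ∀ m ≤ K, ∑ j ∈ Finset.range (m + 1), (s j - t j) ≤ s m - t 0 := by
    intro m
    induction m with
    | zero => simp
    | succ m ih =>
      intro hm
      rw [Finset.sum_range_succ]
      have h1 := ih (by omega)
      have h2 := h.2.1 m (by omega)
      linarith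
  linarith [key K le_rfl, h.2.2]

/-- `BalancedBy K C h`: the sums of `h` over any two interleaving families of `K + 1` points
differ by at most `C`. -/
def BalancedBy (K : ℕ) (C : ℝ) (h : S1 → ℝ) : Prop :=
  ∀ t s : ℕ → ℝ, Interleaved K t s →
    |∑ j ∈ Finset.range (K + 1), (h (t j : S1) - h (s j : S1))| ≤ C

lemma BalancedBy.dualP {k K : ℕ} {C : ℝ} {h : S1 → ℝ} (hh : BalancedBy K C h)
    {g : Fin k → S1 ≃ₜ S1} (hg : ∀ i, IsOPH (g i)) {p : Fin k → ℝ} (hp : ∀ i, 0 ≤ p i)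
    (hsum : ∑ i, p i = 1) : BalancedBy K C (dualP p g h) := by
  intro t s hts
  have e : ∑ j ∈ Finset.range (K + 1), (_root_.dualP p g h (t j : S1)
      - _root_.dualP p g h (s j : S1)) =
      ∑ i, p i * ∑ j ∈ Finset.range (K + 1), (h (g i (t j : S1)) - h (g i (s j : S1))) := by
    simp only [_root_.dualP, ← Finset.sum_sub_distrib, ← mul_sub, Finset.mul_sum]
    exact Finset.sum_comm
  rw [e]
  calc _ ≤ ∑ i, |p i * ∑ j ∈ Finset.range (K + 1), (h (g i (t j : S1)) - h (g i (s j : S1)))| :=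
        Finset.abs_sum_le_sum_abs _ _
    _ ≤ ∑ i, p i * C := by
        refine Finset.sum_le_sum fun i _ => ?_
        obtain ⟨G, hG, -, hG1, hGg⟩ := hg i
        rw [abs_mul, abs_of_nonneg (hp i)]
        refine mul_le_mul_of_nonneg_left ?_ (hp i)
        simpa only [hGg, Function.comp_apply] using hh _ _ (hts.comp hG hG1)
    _ = C := by rw [← Finset.sum_mul, hsum, one_mul]

lemma BalancedBy.iterate_dualP {k K : ℕ} {C : ℝ} {h : S1 → ℝ} (hh : BalancedBy K C h)
    {g : Fin k → S1 ≃ₜ S1} (hg : ∀ i, IsOPH (g i)) {p : Fin k → ℝ} (hp : ∀ i, 0 ≤ p i)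
    (hsum : ∑ i, p i = 1) (n : ℕ) : BalancedBy K C ((_root_.dualP p g)^[n] h) := by
  induction n with
  | zero => exact hh
  | succ n ih =>
    rw [Function.iterate_succ_apply']
    exact ih.dualP hg hp hsum

lemma exists_balancedBy (f : C(S1, ℝ)) {ε : ℝ} (hε : 0 < ε) :
    ∃ B : ℝ, ∀ K : ℕ, BalancedBy K ((K + 1 : ℕ) * ε + B) f := by
  have huc : UniformContinuous fun x : ℝ => f (x : S1) :=
    (CompactSpace.uniformContinuous_of_continuous f.continuous).comp
      (uniformContinuous_of_continuousAt_zero (QuotientAddGroup.mk' _)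
        (AddCircle.continuous_mk' 1).continuousAt)
  obtain ⟨δ, hδ, hf⟩ := Metric.uniformContinuous_iff.1 huc ε hε
  have hB : 0 ≤ 2 * ‖f‖ / δ := by positivity
  have hpt : ∀ x y : ℝ, x < y →
      |f (x : S1) - f (y : S1)| ≤ ε + 2 * ‖f‖ / δ * (y - x) := by
    intro x y hxy
    rcases lt_or_ge (y - x) δ with h | h
    · have h1 := hf (a := x) (b := y) (by rwa [dist_comm, Real.dist_eq, abs_of_pos (sub_pos.2 hxy)])
      rw [Real.dist_eq] at h1
      have := mul_nonneg hB (sub_pos.2 hxy).le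
      linarith
    · have h1 : |f (x : S1) - f (y : S1)| ≤ ‖f‖ + ‖f‖ :=
        (abs_sub _ _).trans (add_le_add (f.norm_coe_le_norm _) (f.norm_coe_le_norm _))
      have h2 : 2 * ‖f‖ ≤ 2 * ‖f‖ / δ * (y - x) := by
        calc 2 * ‖f‖ = 2 * ‖f‖ / δ * δ := by field_simp
          _ ≤ _ := mul_le_mul_of_nonneg_left h hB
      linarith
  refine ⟨2 * ‖f‖ / δ, fun K t s hts => ?_⟩
  calc _ ≤ ∑ j ∈ Finset.range (K + 1), |f (t j : S1) - f (s j : S1)| :=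
        Finset.abs_sum_le_sum_abs _ _
    _ ≤ ∑ j ∈ Finset.range (K + 1), (ε + 2 * ‖f‖ / δ * (s j - t j)) :=
        Finset.sum_le_sum fun j hj =>
          hpt _ _ (hts.1 j (Nat.lt_succ_iff.1 (Finset.mem_range.1 hj)))
    _ = (K + 1 : ℕ) * ε + 2 * ‖f‖ / δ * ∑ j ∈ Finset.range (K + 1), (s j - t j) := by
        rw [Finset.sum_add_distrib, ← Finset.mul_sum]
        simp
    _ ≤ _ := by
        have := mul_le_mul_of_nonneg_left hts.sum_sub_le_one hB
        linarith

lemma continuous_dualP {k : ℕ} (p : Fin k → ℝ) (g : Fin k → S1 ≃ₜ S1) {h : S1 → ℝ}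
    (hh : Continuous h) : Continuous (dualP p g h) :=
  continuous_finsetSum _ fun i _ => continuous_const.mul (hh.comp (g i).continuous)

lemma isFiniteMeasure_markovP {k : ℕ} (p : Fin k → ℝ) (g : Fin k → S1 ≃ₜ S1) (μ : Measure S1)
    [IsFiniteMeasure μ] : IsFiniteMeasure (markovP p g μ) := by
  unfold markovP
  have (i : Fin k) : IsFiniteMeasure (ENNReal.ofReal (p i) • Measure.map (g i) μ) :=
    Measure.smul_finite _ ENNReal.ofReal_ne_top
  infer_instance

lemma integral_markovP {k : ℕ} {p : Fin k → ℝ} (hp : ∀ i, 0 ≤ p i) (g : Fin k → S1 ≃ₜ S1)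
    (μ : Measure S1) [IsFiniteMeasure μ] {h : S1 → ℝ} (hh : Continuous h) :
    ∫ x, h x ∂(markovP p g μ) = ∫ x, dualP p g h x ∂μ := by
  have integrable_of_cont : ∀ (ν : Measure S1) [IsFiniteMeasure ν] (u : S1 → ℝ), Continuous u →
      Integrable u ν := fun ν _ u hu =>
    hu.integrable_of_hasCompactSupport (HasCompactSupport.of_compactSpace u)
  unfold markovP dualP
  rw [integral_finsetSum_measure fun i _ => (integrable_of_cont _ _ hh).smul_measure ENNReal.ofReal_ne_top,
    integral_finsetSum _ fun i _ =>
      integrable_of_cont μ (fun x => p i * h (g i x)) (continuous_const.mul (hh.comp (g i).continuous))]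
  refine Finset.sum_congr rfl fun i _ => ?_
  rw [integral_smul_measure, ENNReal.toReal_ofReal (hp i), integral_const_mul, smul_eq_mul,
    integral_map (g i).continuous.aemeasurable hh.aestronglyMeasurable]

lemma integral_iterate_markovP {k : ℕ} {p : Fin k → ℝ} (hp : ∀ i, 0 ≤ p i)
    (g : Fin k → S1 ≃ₜ S1) (n : ℕ) (μ : Measure S1) [IsFiniteMeasure μ] {h : S1 → ℝ}
    (hh : Continuous h) :
    ∫ x, h x ∂((markovP p g)^[n] μ) = ∫ x, (dualP p g)^[n] h x ∂μ := by
  induction n generalizing h with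
  | zero => rfl
  | succ n ih =>
    have hfin : IsFiniteMeasure ((markovP p g)^[n] μ) := by
      clear ih
      induction n with
      | zero => assumption
      | succ n ihn =>
        rw [Function.iterate_succ_apply']
        exact isFiniteMeasure_markovP p g _
    rw [Function.iterate_succ_apply', integral_markovP hp g _ hh, ih (continuous_dualP p g hh),
      Function.iterate_succ_apply]

lemma integral_uniform_dirac (K : ℕ) (t : ℕ → S1) (h : S1 → ℝ) :
    ∫ x, h x ∂(((K + 1 : ℕ) : ℝ≥0∞)⁻¹ • ∑ j ∈ Finset.range (K + 1), Measure.dirac (t j)) =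
      ((K + 1 : ℕ) : ℝ)⁻¹ * ∑ j ∈ Finset.range (K + 1), h (t j) := by
  rw [integral_smul_measure, integral_finsetSum_measure fun j _ => integrable_dirac (by simp)]
  simp only [integral_dirac, ENNReal.toReal_inv, ENNReal.toReal_natCast, smul_eq_mul]

/-- For an admissible contractive IFS: if for each `K` the `K+1` points
`x_j = π (t K j)` and `y_j = π (s K j)` interleave in cyclic order, and `μ₁^K, μ₂^K` are the
uniform probability measures on these two point sets, then for every continuous `f`,
`lim_{K→∞} limsup_{n→∞} |∫ f d(Pⁿμ₁^K) − ∫ f d(Pⁿμ₂^K)| = 0`. -/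
theorem interleaved_uniform_measures_asymptotically_close {k : ℕ} (g : Fin k → S1 ≃ₜ S1)
    (hg : ∀ i, IsOPH (g i)) (hadm : Admissible g) (hcontr : Contractive g)
    (p : Fin k → ℝ) (hp : ∀ i, 0 < p i) (hsum : ∑ i, p i = 1)
    (t s : ℕ → ℕ → ℝ)
    (horder : ∀ K : ℕ, (∀ j ≤ K, t K j < s K j) ∧ (∀ j < K, s K j < t K (j + 1)) ∧
      s K K < t K 0 + 1)
    (f : C(S1, ℝ)) :
    Tendsto (fun K : ℕ =>
      limsup (fun n : ℕ =>
        |∫ x, f x ∂((markovP p g)^[n]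
            (((K + 1 : ℕ) : ℝ≥0∞)⁻¹ • ∑ j ∈ Finset.range (K + 1), Measure.dirac ((t K j : ℝ) : S1))) -
         ∫ x, f x ∂((markovP p g)^[n]
            (((K + 1 : ℕ) : ℝ≥0∞)⁻¹ • ∑ j ∈ Finset.range (K + 1), Measure.dirac ((s K j : ℝ) : S1)))|)
        atTop)
      atTop (𝓝 0) := by
  have hp0 : ∀ i, 0 ≤ p i := fun i => (hp i).le
  have hfin (K : ℕ) (u : ℕ → S1) : IsFiniteMeasure (((K + 1 : ℕ) : ℝ≥0∞)⁻¹ •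
      ∑ j ∈ Finset.range (K + 1), Measure.dirac (u j)) :=
    Measure.smul_finite _ (by simp)
  have hbound : ∀ ε > 0, ∃ B : ℝ, ∀ K n : ℕ,
      |∫ x, f x ∂((markovP p g)^[n] (((K + 1 : ℕ) : ℝ≥0∞)⁻¹ •
          ∑ j ∈ Finset.range (K + 1), Measure.dirac ((t K j : ℝ) : S1))) -
        ∫ x, f x ∂((markovP p g)^[n] (((K + 1 : ℕ) : ℝ≥0∞)⁻¹ •
          ∑ j ∈ Finset.range (K + 1), Measure.dirac ((s K j : ℝ) : S1)))| ≤
        ε + B / (K + 1 : ℕ) := by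
    intro ε hε
    obtain ⟨B, hB⟩ := exists_balancedBy f hε
    refine ⟨B, fun K n => ?_⟩
    have hK : (0 : ℝ) < (K + 1 : ℕ) := by positivity
    have := hfin K fun j => (t K j : S1)
    have := hfin K fun j => (s K j : S1)
    rw [integral_iterate_markovP hp0 g n _ f.continuous,
      integral_iterate_markovP hp0 g n _ f.continuous,
      integral_uniform_dirac K (fun j => (t K j : S1)),
      integral_uniform_dirac K (fun j => (s K j : S1)), ← mul_sub, ← Finset.sum_sub_distrib,
      abs_mul, abs_of_pos (inv_pos.2 hK)]
    calc _ ≤ ((K + 1 : ℕ) : ℝ)⁻¹ * ((K + 1 : ℕ) * ε + B) :=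
          mul_le_mul_of_nonneg_left ((hB K).iterate_dualP hg hp0 hsum n _ _ (horder K))
            (inv_pos.2 hK).le
      _ = ε + B / (K + 1 : ℕ) := by field_simp
  rw [Metric.tendsto_atTop]
  intro ε hε
  obtain ⟨B, hB⟩ := hbound (ε / 2) (half_pos hε)
  have hlim : Tendsto (fun K : ℕ => B / ((K + 1 : ℕ) : ℝ)) atTop (𝓝 0) :=
    (tendsto_const_div_atTop_nhds_zero_nat B).comp (tendsto_add_atTop_nat 1)
  obtain ⟨N, hN⟩ := eventually_atTop.1 (hlim.eventually (gt_mem_nhds (half_pos hε)))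
  refine ⟨N, fun K hK => ?_⟩
  have hle := limsup_le_of_le (f := atTop)
    (isCoboundedUnder_le_of_le atTop (x := 0) fun n => abs_nonneg _)
    (Eventually.of_forall (hB K))
  have hge := le_limsup_of_frequently_le
    (Frequently.of_forall (f := atTop) fun n : ℕ => abs_nonneg _)
    (isBoundedUnder_of ⟨_, hB K⟩)
  rw [Real.dist_eq, sub_zero, abs_of_nonneg hge]
  linarith [hN K hK]
end
end

section
/- Let Γ={g₁,…,g_k} be a finite admissible set of orientation-preserving circle homeomorphisms and let p=(p₁,…,p_k) be a probability vector with all pᵢ>0. Then the Markov operator P corresponding to (Γ,p) satisfies the e-property: for every continuous f:S¹→ℝ the family of iterates {(P*)ⁿf : n∈ℕ} is equicontinuous, i.e., for every x∈S¹, lim_{y→x} sup_{n∈ℕ} |(P*)ⁿf(y) − (P*)ⁿf(x)| = 0. -/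
open MeasureTheory Filter Topology

noncomputable section

/-- Averaging operator `ψ ↦ ∑ᵢ pᵢ ψ ∘ Gᵢ` on functions on the line. -/
def avgOp {ι : Type*} [Fintype ι] (p : ι → ℝ) (G : ι → ℝ → ℝ) (ψ : ℝ → ℝ) (t : ℝ) : ℝ :=
  ∑ i, p i * ψ (G i t)

/-- Monotone functions commuting with the translation by `1`. -/
def IsDegOne (ψ : ℝ → ℝ) : Prop := Monotone ψ ∧ ∀ t, ψ (t + 1) = ψ t + 1

lemma IsDegOne.add_nat {ψ : ℝ → ℝ} (h : IsDegOne ψ) (t : ℝ) (n : ℕ) : ψ (t + n) = ψ t + n := by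
  induction n with
  | zero => simp
  | succ n ih => push_cast; rw [← add_assoc, h.2, ih]; ring

lemma IsDegOne.add_int {ψ : ℝ → ℝ} (h : IsDegOne ψ) (t : ℝ) (m : ℤ) : ψ (t + m) = ψ t + m := by
  obtain ⟨n, rfl | rfl⟩ := m.eq_nat_or_neg
  · simpa using h.add_nat t n
  · have := h.add_nat (t + ((-(n : ℤ) : ℤ) : ℝ)) n
    push_cast at this ⊢
    rw [show t + -(n : ℝ) + n = t by ring] at this
    linarith

lemma IsDegOne.iterate {ψ : ℝ → ℝ} (h : IsDegOne ψ) (n : ℕ) : IsDegOne ψ^[n] := by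
  refine ⟨h.1.iterate n, ?_⟩
  induction n with
  | zero => simp
  | succ n ih => intro t; rw [Function.iterate_succ_apply', ih, h.2, Function.iterate_succ_apply']

lemma IsDegOne.abs_sub_le {ψ : ℝ → ℝ} (h : IsDegOne ψ) {s t : ℝ} {n : ℕ} (hst : |t - s| ≤ n) :
    |ψ t - ψ s| ≤ n := by
  rw [abs_le] at hst ⊢
  have h1 := h.1 (show t ≤ s + n by linarith)
  have h2 := h.1 (show s ≤ t + n by linarith)
  rw [h.add_nat] at h1 h2
  constructor <;> linarith

section Average

variable {ι : Type*} [Fintype ι] {p : ι → ℝ} {G : ι → ℝ → ℝ}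

lemma IsDegOne.avgOp {ψ : ℝ → ℝ} (h : IsDegOne ψ) (hp : ∀ i, 0 < p i) (hsum : ∑ i, p i = 1)
    (hG : ∀ i, IsDegOne (G i)) : IsDegOne (avgOp p G ψ) := by
  refine ⟨fun s t hst => Finset.sum_le_sum fun i _ =>
    mul_le_mul_of_nonneg_left (h.1 ((hG i).1 hst)) (hp i).le, fun t => ?_⟩
  simp only [_root_.avgOp, (hG _).2, h.2, mul_add, Finset.sum_add_distrib, mul_one, hsum]

lemma isDegOne_iterate_avgOp (hp : ∀ i, 0 < p i) (hsum : ∑ i, p i = 1)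
    (hG : ∀ i, IsDegOne (G i)) (n : ℕ) : IsDegOne ((avgOp p G)^[n] id) := by
  induction n with
  | zero => exact ⟨monotone_id, fun t => rfl⟩
  | succ n ih => rw [Function.iterate_succ_apply']; exact ih.avgOp hp hsum hG

/-- Cesàro averages of the normalized iterates of the identity under `avgOp`. -/
def cesaroLift (p : ι → ℝ) (G : ι → ℝ → ℝ) (n : ℕ) (t : ℝ) : ℝ :=
  (∑ j ∈ Finset.range (n + 1), ((avgOp p G)^[j] id t - (avgOp p G)^[j] id 0)) / (n + 1)

lemma isDegOne_cesaroLift (hp : ∀ i, 0 < p i) (hsum : ∑ i, p i = 1)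
    (hG : ∀ i, IsDegOne (G i)) (n : ℕ) : IsDegOne (cesaroLift p G n) := by
  refine ⟨fun s t hst => ?_, fun t => ?_⟩
  · unfold cesaroLift
    gcongr with j _
    exact (isDegOne_iterate_avgOp hp hsum hG j).1 hst
  · have hn : (n : ℝ) + 1 ≠ 0 := by positivity
    simp only [cesaroLift, (isDegOne_iterate_avgOp hp hsum hG _).2, add_sub_right_comm,
      Finset.sum_add_distrib]
    simp
    field_simp

lemma cesaroLift_zero (n : ℕ) : cesaroLift p G n 0 = 0 := by simp [cesaroLift]

lemma abs_avgOp_cesaroLift_sub_le (hp : ∀ i, 0 < p i) (hsum : ∑ i, p i = 1)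
    (hG : ∀ i, IsDegOne (G i)) {s t : ℝ} {N : ℕ} (hst : |t - s| ≤ N) (n : ℕ) :
    |(avgOp p G (cesaroLift p G n) t - avgOp p G (cesaroLift p G n) s) -
      (cesaroLift p G n t - cesaroLift p G n s)| ≤ 2 * N / (n + 1) := by
  set A : ℕ → ℝ := fun j => (avgOp p G)^[j] id t - (avgOp p G)^[j] id s with hA
  have hn : (0 : ℝ) < n + 1 := by positivity
  have h1 : cesaroLift p G n t - cesaroLift p G n s
      = (∑ j ∈ Finset.range (n + 1), A j) / (n + 1) := by
    simp only [cesaroLift, hA, ← sub_div, ← Finset.sum_sub_distrib]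
    congr 1
    exact Finset.sum_congr rfl fun j _ => by ring
  have h2 : avgOp p G (cesaroLift p G n) t - avgOp p G (cesaroLift p G n) s
      = (∑ j ∈ Finset.range (n + 1), A (j + 1)) / (n + 1) := by
    simp only [hA, Function.iterate_succ_apply']
    simp only [avgOp, cesaroLift, ← Finset.sum_sub_distrib]
    rw [Finset.sum_comm, Finset.sum_div]
    refine Finset.sum_congr rfl fun i _ => ?_
    rw [← mul_sub, ← sub_div, ← Finset.sum_sub_distrib, mul_div_assoc', Finset.mul_sum]
    congr 1
    exact Finset.sum_congr rfl fun j _ => by ring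
  rw [h1, h2, ← sub_div, ← Finset.sum_sub_distrib, Finset.sum_range_sub, abs_div, abs_of_pos hn]
  gcongr
  have h3 : |A (n + 1)| ≤ N := (isDegOne_iterate_avgOp hp hsum hG _).abs_sub_le hst
  have h4 : |A 0| ≤ N := (isDegOne_iterate_avgOp hp hsum hG _).abs_sub_le hst
  have := abs_sub (A (n + 1)) (A 0)
  linarith

/-- There is a degree one monotone function whose increments are invariant under averaging;
it is the distribution function of a stationary measure of the inverse system. -/
theorem exists_isDegOne_avgOp_sub_eq (hp : ∀ i, 0 < p i) (hsum : ∑ i, p i = 1)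
    (hG : ∀ i, IsDegOne (G i)) :
    ∃ φ, IsDegOne φ ∧ ∀ s t, avgOp p G φ t - avgOp p G φ s = φ t - φ s := by
  have hD := isDegOne_cesaroLift hp hsum hG
  have hlim : ∀ t, ∃ l, Tendsto (fun n => cesaroLift p G n t) (hyperfilter ℕ) (𝓝 l) := by
    intro t
    obtain ⟨N, hN⟩ := exists_nat_ge |t - 0|
    obtain ⟨l, -, hl⟩ := (isCompact_Icc (a := -(N : ℝ)) (b := N)).ultrafilter_le_nhds
      ((hyperfilter ℕ).map fun n => cesaroLift p G n t) (by
        rw [le_principal_iff]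
        refine Ultrafilter.mem_map.2 (Eventually.of_forall fun n => ?_)
        have := (hD n).abs_sub_le hN
        rw [cesaroLift_zero, sub_zero] at this
        exact abs_le.1 this)
    exact ⟨l, hl⟩
  choose φ hφ using hlim
  refine ⟨φ, ⟨fun s t hst => le_of_tendsto_of_tendsto (hφ s) (hφ t)
      (Eventually.of_forall fun n => (hD n).1 hst),
    fun t => tendsto_nhds_unique (hφ (t + 1)) ?_⟩, fun s t => ?_⟩
  · simpa only [(hD _).2] using (hφ t).add_const 1
  · have hav : ∀ u, Tendsto (fun n => avgOp p G (cesaroLift p G n) u) (hyperfilter ℕ)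
        (𝓝 (avgOp p G φ u)) := fun u =>
      tendsto_finsetSum _ fun i _ => (hφ (G i u)).const_mul (p i)
    obtain ⟨N, hN⟩ := exists_nat_ge |t - s|
    have hlim := ((hav t).sub (hav s)).sub ((hφ t).sub (hφ s))
    have hzero : Tendsto (fun n : ℕ => 2 * (N : ℝ) / (n + 1)) (hyperfilter ℕ) (𝓝 0) := by
      have := (tendsto_const_div_atTop_nhds_zero_nat (2 * (N : ℝ))).comp (tendsto_add_atTop_nat 1)
      refine Tendsto.mono_left ?_ Nat.hyperfilter_le_atTop
      simpa [Function.comp_def] using this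
    exact sub_eq_zero.1 (tendsto_nhds_unique hlim
      (squeeze_zero_norm (abs_avgOp_cesaroLift_sub_le hp hsum hG hN) hzero))

end Average

section Jump

/-- The jump of a function at a point. -/
def jump (φ : ℝ → ℝ) (t : ℝ) : ℝ := Function.rightLim φ t - Function.leftLim φ t

lemma jump_nonneg {φ : ℝ → ℝ} (h : Monotone φ) (t : ℝ) : 0 ≤ jump φ t :=
  sub_nonneg.2 (h.leftLim_le_rightLim le_rfl)

lemma IsDegOne.tendsto_comp_rightLim {φ H : ℝ → ℝ} (h : IsDegOne φ) (hH : StrictMono H)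
    (hc : Continuous H) (t : ℝ) :
    Tendsto (fun s => φ (H s)) (𝓝[>] t) (𝓝 (Function.rightLim φ (H t))) :=
  (h.1.tendsto_rightLim (H t)).comp
    (tendsto_nhdsWithin_of_tendsto_nhds_of_eventually_within _
      (hc.continuousAt.mono_left nhdsWithin_le_nhds)
      (eventually_nhdsWithin_of_forall fun _ hs => hH hs))

lemma IsDegOne.tendsto_comp_leftLim {φ H : ℝ → ℝ} (h : IsDegOne φ) (hH : StrictMono H)
    (hc : Continuous H) (t : ℝ) :
    Tendsto (fun s => φ (H s)) (𝓝[<] t) (𝓝 (Function.leftLim φ (H t))) :=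
  (h.1.tendsto_leftLim (H t)).comp
    (tendsto_nhdsWithin_of_tendsto_nhds_of_eventually_within _
      (hc.continuousAt.mono_left nhdsWithin_le_nhds)
      (eventually_nhdsWithin_of_forall fun _ hs => hH hs))

lemma IsDegOne.jump_add_one {φ : ℝ → ℝ} (h : IsDegOne φ) (t : ℝ) :
    jump φ (t + 1) = jump φ t := by
  have hm : StrictMono fun s : ℝ => s + 1 := strictMono_id.add_const 1
  have hr := tendsto_nhds_unique (h.tendsto_comp_rightLim hm (by fun_prop) t)
    (by simpa only [h.2] using (h.1.tendsto_rightLim t).add_const 1)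
  have hl := tendsto_nhds_unique (h.tendsto_comp_leftLim hm (by fun_prop) t)
    (by simpa only [h.2] using (h.1.tendsto_leftLim t).add_const 1)
  rw [jump, hr, hl, jump]
  ring

lemma IsDegOne.jump_fract {φ : ℝ → ℝ} (h : IsDegOne φ) (t : ℝ) :
    jump φ (Int.fract t) = jump φ t := by
  have hper : Function.Periodic (jump φ) 1 := h.jump_add_one
  have := hper.int_mul ⌊t⌋ (Int.fract t)
  rwa [mul_one, Int.fract_add_floor, eq_comm] at this

lemma card_mul_le_of_le_jump {φ : ℝ → ℝ} (h : Monotone φ) {c a : ℝ} (F : Finset ℝ) :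
    (∀ x ∈ F, a < x ∧ c ≤ jump φ x) → ∀ b, a < b → (∀ x ∈ F, x < b) →
      F.card * c ≤ Function.leftLim φ b - φ a := by
  induction F using Finset.induction_on_max with
  | empty => intro _ b hab _; simpa using h.le_leftLim hab
  | insert m F hm ih =>
    intro hF b _ hb
    have h1 := ih (fun x hx => hF x (Finset.mem_insert_of_mem hx)) m
      (hF m (Finset.mem_insert_self _ _)).1 hm
    have h2 := (hF m (Finset.mem_insert_self _ _)).2
    have h3 := h.rightLim_le_leftLim (hb m (Finset.mem_insert_self _ _))
    rw [Finset.card_insert_of_notMem fun hmem => (hm m hmem).false]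
    unfold jump at h2
    push_cast
    linarith

lemma IsDegOne.finite_le_jump {φ : ℝ → ℝ} (h : IsDegOne φ) {c : ℝ} (hc : 0 < c) :
    {t | t ∈ Set.Ico (0 : ℝ) 1 ∧ c ≤ jump φ t}.Finite := by
  by_contra hinf
  obtain ⟨n, hn⟩ := exists_nat_gt (2 / c)
  obtain ⟨F, hF, hcard⟩ := Set.Infinite.exists_subset_card_eq hinf n
  have h1 := card_mul_le_of_le_jump h.1 (c := c) (a := -1) F
    (fun x hx => ⟨by linarith [(hF hx).1.1], (hF hx).2⟩) 1 (by norm_num)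
    (fun x hx => (hF hx).1.2)
  have h2 := h.1.leftLim_le (le_refl (1 : ℝ))
  have h3 := h.add_nat (-1) 2
  norm_num at h3
  rw [hcard] at h1
  rw [div_lt_iff₀ hc] at hn
  linarith

lemma IsDegOne.exists_forall_jump_le {φ : ℝ → ℝ} (h : IsDegOne φ) :
    ∃ t, ∀ s, jump φ s ≤ jump φ t := by
  by_cases hpos : ∃ t₀, 0 < jump φ t₀
  · obtain ⟨t₀, ht₀⟩ := hpos
    have hmem : ∀ s, jump φ t₀ ≤ jump φ s →
        Int.fract s ∈ {t | t ∈ Set.Ico (0 : ℝ) 1 ∧ jump φ t₀ ≤ jump φ t} := fun s hs =>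
      ⟨⟨Int.fract_nonneg s, Int.fract_lt_one s⟩, by rwa [h.jump_fract]⟩
    obtain ⟨t, ht, hmax⟩ := Set.exists_max_image _ (jump φ) (h.finite_le_jump ht₀)
      ⟨_, hmem t₀ le_rfl⟩
    refine ⟨t, fun s => ?_⟩
    rcases le_total (jump φ t₀) (jump φ s) with hs | hs
    · simpa only [h.jump_fract] using hmax _ (hmem s hs)
    · exact hs.trans ht.2
  · push Not at hpos
    exact ⟨0, fun s => (hpos s).trans (jump_nonneg h.1 0)⟩

variable {ι : Type*} [Fintype ι] {p : ι → ℝ} {G : ι → ℝ → ℝ}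

lemma sum_jump_eq {φ : ℝ → ℝ} (h : IsDegOne φ) (hGm : ∀ i, StrictMono (G i))
    (hGc : ∀ i, Continuous (G i))
    (hinv : ∀ s t, avgOp p G φ t - avgOp p G φ s = φ t - φ s) (t : ℝ) :
    ∑ i, p i * jump φ (G i t) = jump φ t := by
  have hr : Tendsto (avgOp p G φ) (𝓝[>] t) (𝓝 (∑ i, p i * Function.rightLim φ (G i t))) :=
    tendsto_finsetSum _ fun i _ => (h.tendsto_comp_rightLim (hGm i) (hGc i) t).const_mul _
  have hl : Tendsto (avgOp p G φ) (𝓝[<] t) (𝓝 (∑ i, p i * Function.leftLim φ (G i t))) :=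
    tendsto_finsetSum _ fun i _ => (h.tendsto_comp_leftLim (hGm i) (hGc i) t).const_mul _
  have heq : ∀ s, avgOp p G φ s = φ s + (avgOp p G φ t - φ t) := fun s => by
    linarith [hinv s t]
  have hr' := tendsto_nhds_unique hr
    (((h.1.tendsto_rightLim t).add_const _).congr fun s => (heq s).symm)
  have hl' := tendsto_nhds_unique hl
    (((h.1.tendsto_leftLim t).add_const _).congr fun s => (heq s).symm)
  simp only [jump, mul_sub, Finset.sum_sub_distrib, hr', hl']
  ring

/-- If no power of some `G i` has a fixed point modulo `1`, then a degree one function with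
invariant increments is continuous. -/
lemma continuous_of_avgOp_sub_eq {φ : ℝ → ℝ} (h : IsDegOne φ) (hp : ∀ i, 0 < p i)
    (hsum : ∑ i, p i = 1) (hGm : ∀ i, StrictMono (G i)) (hGc : ∀ i, Continuous (G i))
    (hinv : ∀ s t, avgOp p G φ t - avgOp p G φ s = φ t - φ s) (i : ι) (hGi : IsDegOne (G i))
    (hper : ∀ n : ℕ, ∀ m : ℤ, ∀ t, (G i)^[n + 1] t ≠ t + m) : Continuous φ := by
  obtain ⟨t₀, ht₀⟩ := h.exists_forall_jump_le
  have hstep : ∀ t, jump φ t = jump φ t₀ → jump φ (G i t) = jump φ t₀ := by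
    intro t ht
    by_contra hne
    have hlt : ∑ j, p j * jump φ (G j t) < ∑ j, p j * jump φ t₀ :=
      Finset.sum_lt_sum (fun j _ => mul_le_mul_of_nonneg_left (ht₀ _) (hp j).le)
        ⟨i, Finset.mem_univ i, mul_lt_mul_of_pos_left (lt_of_le_of_ne (ht₀ _) hne) (hp i)⟩
    rw [sum_jump_eq h hGm hGc hinv, ← Finset.sum_mul, hsum, one_mul, ht] at hlt
    exact hlt.false
  have horb : ∀ n : ℕ, jump φ ((G i)^[n] t₀) = jump φ t₀ := by
    intro n
    induction n with
    | zero => rfl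
    | succ n ih => rw [Function.iterate_succ_apply']; exact hstep _ ih
  have hzero : ¬ 0 < jump φ t₀ := by
    intro hpos
    have hmaps : Set.MapsTo (fun n : ℕ => Int.fract ((G i)^[n] t₀)) Set.univ
        {t | t ∈ Set.Ico (0 : ℝ) 1 ∧ jump φ t₀ ≤ jump φ t} := fun n _ =>
      ⟨⟨Int.fract_nonneg _, Int.fract_lt_one _⟩, by rw [h.jump_fract, horb]⟩
    obtain ⟨n, -, n', -, hlt, heq⟩ := Set.infinite_univ.exists_lt_map_eq_of_mapsTo hmaps
      (h.finite_le_jump hpos)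
    obtain ⟨m, hm⟩ := Int.fract_eq_fract.1 heq.symm
    obtain ⟨d, rfl⟩ := Nat.exists_eq_add_of_lt hlt
    refine hper d m t₀ (((hGm i).iterate n).injective ?_)
    rw [(hGi.iterate n).add_int, ← Function.iterate_add_apply, ← hm, ← add_assoc]
    ring
  refine continuous_iff_continuousAt.2 fun t =>
    h.1.continuousAt_iff_leftLim_eq_rightLim.2 ?_
  have h1 := jump_nonneg h.1 t
  have h2 := ht₀ t
  unfold jump at h1 h2 hzero
  linarith

end Jump

/-- If the forward orbit of a point under `H` is dense modulo `1` and no power of `H` has a fixed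
point modulo `1`, then a continuous degree one function whose intervals of constancy are mapped by
`H` to intervals of constancy is strictly increasing. -/
lemma strictMono_of_dense_orbit {φ H : ℝ → ℝ} (h : IsDegOne φ) (hφ : Continuous φ)
    (hHm : StrictMono H) (hHc : Continuous H) (hH : IsDegOne H)
    (hflat : ∀ s t, s < t → φ s = φ t → φ (H s) = φ (H t)) {x : ℝ}
    (hdense : ∀ N : ℕ, ∀ a b : ℝ, a < b → ∃ n ≥ N, ∃ m : ℤ, H^[n] x + m ∈ Set.Ioo a b)
    (hper : ∀ n : ℕ, ∀ m : ℤ, ∀ t, H^[n + 1] t ≠ t + m) : StrictMono φ := by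
  by_contra hns
  obtain ⟨s, t, hst, hfl⟩ : ∃ s t, s < t ∧ φ s = φ t := by
    by_contra! hne
    exact hns fun s t hst => lt_of_le_of_ne (h.1 hst.le) (hne s t hst)
  obtain ⟨j, -, k, hj⟩ := hdense 0 s t hst
  set u := H^[j] x + k with hu
  set S := {v | v ≤ u ∧ φ v = φ u} with hS
  have hflatu : ∀ v, s ≤ v → v ≤ t → φ v = φ u := fun v hv hv' => by
    linarith [h.1 hv, h.1 hv', h.1 hj.1.le, h.1 hj.2.le]
  have hsS : s ∈ S := ⟨hj.1.le, hflatu s le_rfl hst.le⟩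
  have hbdd : BddBelow S := ⟨u - 1, fun v hv => by
    by_contra! hlt
    have h1 := h.1 hlt.le
    have h2 := h.2 (u - 1)
    rw [sub_add_cancel] at h2
    linarith [hv.2]⟩
  have hclosed : IsClosed S := isClosed_Iic.inter (isClosed_eq hφ continuous_const)
  set a := sInf S with ha
  have haS : a ∈ S := hclosed.csInf_mem ⟨s, hsS⟩ hbdd
  have has : a ≤ s := csInf_le hbdd hsS
  obtain ⟨n', hn', m, hm⟩ := hdense (j + 1) s u hj.1
  obtain ⟨n, rfl⟩ := Nat.exists_eq_add_of_le hn'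
  have hHu : H^[n + 1] u = H^[j + 1 + n] x + k := by
    rw [hu, (hH.iterate _).add_int, ← Function.iterate_add_apply]
    congr 2
    omega
  have hflat' : ∀ N : ℕ, φ (H^[N] a) = φ (H^[N] u) := by
    intro N
    induction N with
    | zero => exact haS.2
    | succ N ih =>
      rw [Function.iterate_succ_apply', Function.iterate_succ_apply']
      exact hflat _ _ ((hHm.iterate N) (has.trans_lt hj.1)) ih
  have hK : ∀ t, φ (H^[n + 1] t + (m - k : ℤ)) = φ (H^[n + 1] t) + (m - k : ℤ) := fun t =>
    h.add_int _ _
  have hlt : H^[n + 1] u + (m - k : ℤ) < u := by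
    rw [hHu]; push_cast; linarith [hm.2]
  have hge : a ≤ H^[n + 1] a + (m - k : ℤ) := by
    refine csInf_le hbdd ⟨le_trans ?_ hlt.le, ?_⟩
    · gcongr
      exact (hHm.iterate _).monotone haS.1
    · rw [hK, hflat', ← hK, hHu]
      push_cast
      rw [show H^[j + 1 + n] x + k + ((m : ℝ) - k) = H^[j + 1 + n] x + m by ring]
      exact hflatu _ hm.1.le (hm.2.trans hj.2).le
  obtain ⟨c, -, hc⟩ := intermediate_value_Icc' haS.1
    (f := fun t => H^[n + 1] t + (m - k : ℤ) - t) (by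
      have := hHc.iterate (n + 1)
      fun_prop) (show (0 : ℝ) ∈ _ from ⟨by linarith, by linarith⟩)
  refine hper n (-(m - k)) c ?_
  push_cast at hc ⊢
  linarith

/-- A continuous integer-periodic function is controlled by the increments of a continuous
strictly increasing degree one function. -/
lemma exists_abs_sub_le_add_mul {φ F : ℝ → ℝ} (h : IsDegOne φ) (hφ : Continuous φ)
    (hm : StrictMono φ) (hF : UniformContinuous F) {B : ℝ} (hB : ∀ t, |F t| ≤ B) {ε : ℝ}
    (hε : 0 < ε) :
    ∃ K, 0 ≤ K ∧ ∀ s t, s ≤ t → |F t - F s| ≤ ε + K * (φ t - φ s) := by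
  obtain ⟨δ, hδ, hFδ⟩ := Metric.uniformContinuous_iff.1 hF ε hε
  obtain ⟨r, -, hr⟩ := isCompact_Icc.exists_isMinOn (Set.nonempty_Icc.2 (zero_le_one' ℝ))
    (f := fun s => φ (s + δ) - φ s) (by fun_prop)
  set c := φ (r + δ) - φ r with hc
  have hcpos : 0 < c := sub_pos.2 (hm (by linarith))
  have hcle : ∀ s, c ≤ φ (s + δ) - φ s := by
    intro s
    have h1 : c ≤ φ (Int.fract s + δ) - φ (Int.fract s) :=
      hr (show Int.fract s ∈ Set.Icc (0 : ℝ) 1 from ⟨Int.fract_nonneg s, (Int.fract_lt_one s).le⟩)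
    have h2 := h.add_int (Int.fract s) ⌊s⌋
    have h3 := h.add_int (Int.fract s + δ) ⌊s⌋
    rw [Int.fract_add_floor] at h2
    rw [add_right_comm, Int.fract_add_floor] at h3
    linarith
  have hB0 : 0 ≤ B := (abs_nonneg _).trans (hB 0)
  refine ⟨2 * B / c, by positivity, fun s t hst => ?_⟩
  have hinc : 0 ≤ φ t - φ s := sub_nonneg.2 (h.1 hst)
  rcases lt_or_ge (t - s) δ with hlt | hge
  · have : dist (F t) (F s) < ε := hFδ (by rwa [Real.dist_eq, abs_of_nonneg (by linarith)])
    rw [Real.dist_eq] at this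
    have : 0 ≤ 2 * B / c * (φ t - φ s) := by positivity
    linarith
  · have h1 : c ≤ φ t - φ s := by
      linarith [hcle s, h.1 (show s + δ ≤ t by linarith)]
    have h2 : 2 * B ≤ 2 * B / c * (φ t - φ s) := by
      rw [div_mul_eq_mul_div, le_div_iff₀ hcpos]
      gcongr
    have := abs_sub (F t) (F s)
    linarith [hB s, hB t]

lemma abs_avgOp_sub_le {ι : Type*} [Fintype ι] {p : ι → ℝ} {G : ι → ℝ → ℝ} {φ ψ : ℝ → ℝ}
    (hp : ∀ i, 0 < p i) (hsum : ∑ i, p i = 1) (hG : ∀ i, Monotone (G i))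
    (hinv : ∀ s t, avgOp p G φ t - avgOp p G φ s = φ t - φ s) {ε K : ℝ}
    (h : ∀ s t, s ≤ t → |ψ t - ψ s| ≤ ε + K * (φ t - φ s)) (s t : ℝ) (hst : s ≤ t) :
    |avgOp p G ψ t - avgOp p G ψ s| ≤ ε + K * (φ t - φ s) := by
  calc |avgOp p G ψ t - avgOp p G ψ s| = |∑ i, p i * (ψ (G i t) - ψ (G i s))| := by
        simp only [avgOp, mul_sub, Finset.sum_sub_distrib]
    _ ≤ ∑ i, p i * (ε + K * (φ (G i t) - φ (G i s))) := by
        refine (Finset.abs_sum_le_sum_abs _ _).trans (Finset.sum_le_sum fun i _ => ?_)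
        rw [abs_mul, abs_of_pos (hp i)]
        exact mul_le_mul_of_nonneg_left (h _ _ (hG i hst)) (hp i).le
    _ = ε + K * (avgOp p G φ t - avgOp p G φ s) := by
        simp only [avgOp, mul_add, Finset.sum_add_distrib, ← Finset.sum_mul, hsum, one_mul,
          ← Finset.sum_sub_distrib, Finset.mul_sum]
        congr 1
        exact Finset.sum_congr rfl fun i _ => by ring
    _ = ε + K * (φ t - φ s) := by rw [hinv]

section Circle

instance : Nontrivial S1 :=
  ⟨⟨((0 : ℝ) : S1), ((1 / 2 : ℝ) : S1), fun h => by
    rw [AddCircle.coe_eq_coe_iff_of_mem_Ico (a := 0) (by norm_num) (by norm_num)] at h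
    norm_num at h⟩⟩

lemma not_countable_circle : ¬ (Set.univ : Set S1).Countable := by
  intro h
  have hinj : Set.InjOn (fun t : ℝ => (t : S1)) (Set.Ico 0 1) := fun s hs t ht hst =>
    (AddCircle.coe_eq_coe_iff_of_mem_Ico (a := 0) (by simpa using hs) (by simpa using ht)).1 hst
  have h1 : (Set.Ico (0 : ℝ) 1).Countable :=
    Set.MapsTo.countable_of_injOn (Set.mapsTo_univ _ _) hinj h
  have h2 := h1.measure_zero volume
  simp at h2

lemma coe_add_int (t : ℝ) (m : ℤ) : ((t + m : ℝ) : S1) = (t : S1) := by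
  rw [AddCircle.coe_add, add_eq_left]
  exact (AddCircle.coe_eq_zero_iff (1 : ℝ)).2 ⟨m, by simp⟩

lemma exists_int_add_of_coe_eq {s t : ℝ} (h : (s : S1) = (t : S1)) : ∃ m : ℤ, s + m = t := by
  obtain ⟨m, hm⟩ := (AddCircle.coe_eq_zero_iff (1 : ℝ)).1
    (show ((t - s : ℝ) : S1) = 0 by rw [AddCircle.coe_sub, h, sub_self])
  refine ⟨m, ?_⟩
  simp only [zsmul_eq_mul, mul_one] at hm
  linarith

variable {h : S1 ≃ₜ S1} {G : ℝ → ℝ}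

lemma coe_iterate_lift (hlift : ∀ t : ℝ, h (t : S1) = (G t : S1)) (n : ℕ) (t : ℝ) :
    ((G^[n] t : ℝ) : S1) = h^[n] (t : S1) := by
  induction n with
  | zero => rfl
  | succ n ih => rw [Function.iterate_succ_apply', Function.iterate_succ_apply', ← ih, hlift]

/-- A circle homeomorphism with a dense forward orbit has no periodic point. -/
lemma iterate_lift_ne_add_int (hGm : StrictMono G) (hG : IsDegOne G)
    (hlift : ∀ t : ℝ, h (t : S1) = (G t : S1)) {x : S1}
    (hdense : Dense (Set.range fun n : ℕ => h^[n + 1] x)) (n : ℕ) (m : ℤ) (t₀ : ℝ) :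
    G^[n + 1] t₀ ≠ t₀ + m := by
  intro heq
  set H : ℝ → ℝ := fun t => G^[n + 1] t + (-m : ℤ) with hH
  have hHd : IsDegOne H := ⟨((hGm.iterate _).add_const _).monotone, fun t => by
    simp only [hH, (hG.iterate (n + 1)).2]; ring⟩
  have hfix : H t₀ = t₀ := by simp only [hH, heq]; push_cast; ring
  have hfix' : H (t₀ + 1) = t₀ + 1 := by rw [hHd.2, hfix]
  have hHlift : ∀ t : ℝ, (h^[n + 1]) (t : S1) = (H t : S1) := fun t => by
    rw [hH, coe_add_int, coe_iterate_lift hlift]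
  have hHiter : ∀ (j : ℕ) (t : ℝ), ((H^[j] t : ℝ) : S1) = h^[(n + 1) * j] (t : S1) := by
    intro j t
    induction j with
    | zero => rfl
    | succ j ih =>
      rw [Function.iterate_succ_apply', ← hHlift, ih, ← Function.iterate_add_apply]
      rw [Nat.mul_succ, Nat.add_comm]
  obtain ⟨u, hu, rfl⟩ : ∃ u ∈ Set.Icc t₀ (t₀ + 1), (u : S1) = x := by
    obtain ⟨u, hu⟩ := (AddCircle.equivIco (1 : ℝ) t₀).symm.surjective x
    exact ⟨u, Set.Ico_subset_Icc_self u.2, hu⟩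
  have hmem : ∀ j, H^[j] u ∈ Set.Icc t₀ (t₀ + 1) := fun j =>
    ⟨(Function.iterate_fixed hfix j).symm.le.trans ((hHd.1.iterate j) hu.1),
      ((hHd.1.iterate j) hu.2).trans (Function.iterate_fixed hfix' j).le⟩
  obtain ⟨l, hl⟩ : ∃ l, Tendsto (fun j => H^[j] u) atTop (𝓝 l) := by
    rcases le_total u (H u) with hle | hle
    · exact ⟨_, tendsto_atTop_ciSup (hHd.1.monotone_iterate_of_le_map hle)
        ⟨t₀ + 1, Set.forall_mem_range.2 fun j => (hmem j).2⟩⟩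
    · exact ⟨_, tendsto_atTop_ciInf (hHd.1.antitone_iterate_of_map_le hle)
        ⟨t₀, Set.forall_mem_range.2 fun j => (hmem j).1⟩⟩
  set C : Set S1 := (fun t : ℝ => (t : S1)) '' insert l (Set.range fun j => H^[j] u) with hC
  have hCcomp : IsCompact C := hl.isCompact_insert_range.image (AddCircle.continuous_mk' 1)
  have hCcount : C.Countable := ((Set.countable_range _).insert l).image _
  set D : Set S1 := ⋃ r ∈ Finset.range (n + 1), h^[r] '' C with hD
  have hDcomp : IsCompact D := (Finset.range (n + 1)).isCompact_biUnion fun r _ =>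
    hCcomp.image (h.continuous.iterate r)
  have hDcount : D.Countable :=
    (Finset.range (n + 1)).countable_toSet.biUnion fun r _ => hCcount.image _
  have hsub : (Set.range fun N : ℕ => h^[N + 1] (u : S1)) ⊆ D := by
    rintro _ ⟨N, rfl⟩
    refine Set.mem_biUnion (x := (N + 1) % (n + 1))
      (Finset.mem_coe.2 (Finset.mem_range.2 (Nat.mod_lt _ n.succ_pos)))
      ⟨_, ⟨_, Set.mem_insert_of_mem _ ⟨(N + 1) / (n + 1), rfl⟩, rfl⟩, ?_⟩
    simp only [hHiter]
    rw [← Function.iterate_add_apply, Nat.mod_add_div]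
  refine not_countable_circle (hDcount.mono ?_)
  rw [← hdense.closure_eq]
  exact closure_minimal hsub hDcomp.isClosed

lemma exists_iterate_lift_add_int_mem_Ioo (hlift : ∀ t : ℝ, h (t : S1) = (G t : S1)) {x : ℝ}
    (hdense : Dense (Set.range fun n : ℕ => h^[n + 1] (x : S1))) (N : ℕ) {a b : ℝ} (hab : a < b) :
    ∃ n ≥ N, ∃ m : ℤ, G^[n] x + m ∈ Set.Ioo a b := by
  have hd := hdense.sdiff_finite
    ((Finset.range N).finite_toSet.image fun n : ℕ => h^[n + 1] (x : S1))
  obtain ⟨_, ⟨s, hs, rfl⟩, ⟨n, hns⟩, hn⟩ := hd.inter_open_nonempty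
    ((fun t : ℝ => (t : S1)) '' Set.Ioo a b) (QuotientAddGroup.isOpenMap_coe _ isOpen_Ioo)
    ((Set.nonempty_Ioo.2 hab).image _)
  have hnN : N ≤ n := by
    by_contra! hlt
    exact hn ⟨n, by simpa using hlt, hns⟩
  obtain ⟨m, rfl⟩ := exists_int_add_of_coe_eq
    (show ((G^[n + 1] x : ℝ) : S1) = (s : S1) by rw [coe_iterate_lift hlift]; exact hns)
  exact ⟨n + 1, by omega, m, hs⟩

lemma dualP_iterate_coe {k : ℕ} {g : Fin k → S1 ≃ₜ S1} {G : Fin k → ℝ → ℝ} (p : Fin k → ℝ)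
    (hlift : ∀ i, ∀ t : ℝ, g i (t : S1) = (G i t : S1)) (f : S1 → ℝ) (n : ℕ) (t : ℝ) :
    (dualP p g)^[n] f (t : S1) = (avgOp p G)^[n] (fun s => f (s : S1)) t := by
  induction n generalizing t with
  | zero => rfl
  | succ n ih =>
    rw [Function.iterate_succ_apply', Function.iterate_succ_apply']
    simp only [dualP, avgOp, hlift, ih]

end Circle

/-- The Markov operator of an admissible IFS satisfies the e-property:
for every continuous `f`, the family of iterates `{(P*)ⁿ f : n ∈ ℕ}` is equicontinuous. -/
theorem admissible_ifs_e_property {k : ℕ} (g : Fin k → S1 ≃ₜ S1)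
    (hg : ∀ i, IsOPH (g i)) (hadm : Admissible g)
    (p : Fin k → ℝ) (hp : ∀ i, 0 < p i) (hsum : ∑ i, p i = 1) :
    ∀ f : C(S1, ℝ), Equicontinuous (fun n : ℕ => (dualP p g)^[n] f) := by
  choose G hGm hGc hG1 hlift using hg
  have hG : ∀ i, IsDegOne (G i) := fun i => ⟨(hGm i).monotone, hG1 i⟩
  obtain ⟨i, x, hx⟩ := hadm
  obtain ⟨u, rfl⟩ := QuotientAddGroup.mk_surjective x
  obtain ⟨φ, hφ, hinv⟩ := exists_isDegOne_avgOp_sub_eq hp hsum hG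
  have hper := iterate_lift_ne_add_int (hGm i) (hG i) (hlift i) hx
  have hφc := continuous_of_avgOp_sub_eq hφ hp hsum hGm hGc hinv i (hG i) hper
  have hφm : StrictMono φ := by
    refine strictMono_of_dense_orbit hφ hφc (hGm i) (hGc i) (hG i) (fun s t hst hfl => ?_)
      (fun N a b => exists_iterate_lift_add_int_mem_Ioo (hlift i) hx N) hper
    have hle : ∀ j, φ (G j s) ≤ φ (G j t) := fun j => hφ.1 ((hG j).1 hst.le)
    have hsum_eq : avgOp p G φ s = avgOp p G φ t := by linarith [hinv s t]
    have := (Finset.sum_eq_sum_iff_of_le fun j _ =>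
      mul_le_mul_of_nonneg_left (hle j) (hp j).le).1 hsum_eq i (Finset.mem_univ i)
    exact mul_left_cancel₀ (hp i).ne' this
  intro f y
  obtain ⟨t, rfl⟩ := QuotientAddGroup.mk_surjective y
  rw [Metric.equicontinuousAt_iff_right]
  intro ε hε
  have hF : UniformContinuous fun s : ℝ => f (s : S1) :=
    (CompactSpace.uniformContinuous_of_continuous f.continuous).comp
      (uniformContinuous_of_continuousAt_zero (QuotientAddGroup.mk' (AddSubgroup.zmultiples (1 : ℝ)))
        (AddCircle.continuous_mk' 1).continuousAt)
  obtain ⟨K, hK, hFK⟩ := exists_abs_sub_le_add_mul hφ hφc hφm hF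
    (fun s => f.norm_coe_le_norm (s : S1)) (half_pos hε)
  have hiter : ∀ n s t, s ≤ t → |(avgOp p G)^[n] (fun s => f (s : S1)) t -
      (avgOp p G)^[n] (fun s => f (s : S1)) s| ≤ ε / 2 + K * (φ t - φ s) := by
    intro n
    induction n with
    | zero => exact hFK
    | succ n ih =>
      rw [Function.iterate_succ_apply']
      exact abs_avgOp_sub_le hp hsum (fun i => (hG i).1) hinv ih
  have hnear : ∀ᶠ s in 𝓝 t, K * |φ s - φ t| < ε / 2 := by
    have hc : Continuous fun s => K * |φ s - φ t| := by fun_prop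
    exact hc.continuousAt.eventually_lt continuousAt_const (by simpa using half_pos hε)
  rw [QuotientAddGroup.nhds_eq, eventually_map]
  filter_upwards [hnear] with s hs n
  rw [Real.dist_eq]
  rw [dualP_iterate_coe p hlift, dualP_iterate_coe p hlift]
  rcases le_total s t with hst | hst
  · have h1 := hiter n s t hst
    rw [abs_sub_comm, abs_of_nonneg (sub_nonneg.2 (hφ.1 hst))] at hs
    linarith
  · have h1 := hiter n t s hst
    rw [abs_of_nonneg (sub_nonneg.2 (hφ.1 hst))] at hs
    rw [abs_sub_comm]
    linarith
end
end
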